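/- arXiv:1708.06024 — 5 statements merged into one kernel-verified Lean document; each statement's English description precedes it below -/
import Mathlib

section
/- Fix integers N, k ≥ 1 and set n = Nk. The map Per, sending a pair (λ, T), where λ = (m_1, …, m_N) ∈ ℤ^N is dominant and T is a standard tableau of shape D(λ), to the unique function f on the N×∞ strip {(j,m) : 1 ≤ j ≤ N, m ∈ ℤ} satisfying f(j, m_N + c) = T(j, c) for every box (j, c) of D(λ) and f(j, m + k) = f(j, m) + n for all (j, m), is a well-defined bijection from the disjoint union, over all dominant λ ∈ ℤ^N, of the sets of standard tableaux of shape D(λ), onto the set psyt(k^N) of n-periodic standard tableaux of shape (k^N). In particular for each such (λ, T) the function f is an n-periodic standard tableau. -/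
noncomputable section

/-- A vector `λ ∈ ℤ^N` is dominant if its coordinates are weakly decreasing. -/
def Dominant {N : ℕ} (lam : Fin N → ℤ) : Prop :=
  ∀ i j : Fin N, i ≤ j → lam j ≤ lam i

/-- `m_N`, the last coordinate of `λ` (the argument `j` only witnesses `N > 0`). -/
def lastCoord {N : ℕ} (lam : Fin N → ℤ) (j : Fin N) : ℤ :=
  lam ⟨N - 1, by have := j.isLt; omega⟩

/-- `γ_j = m_j - m_N`. -/
def gammaOf {N : ℕ} (lam : Fin N → ℤ) (j : Fin N) : ℤ := lam j - lastCoord lam j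

/-- Membership of a box `(j, c)` in the skew diagram
`D(λ) = {(j,c) : γ_j < c ≤ γ_j + k}`. -/
def InD (k : ℕ) {N : ℕ} (lam : Fin N → ℤ) (b : Fin N × ℤ) : Prop :=
  gammaOf lam b.1 < b.2 ∧ b.2 ≤ gammaOf lam b.1 + (k : ℤ)

/-- A standard tableau of shape `D(λ)`, encoded via its entry function
`E : boxes → ℤ` (normalised to be `0` off the diagram): `E` restricts to a
bijection of `D(λ)` onto `{1, …, N*k}` which strictly increases along rows and
down columns. -/
def IsStdTabE (N k : ℕ) (lam : Fin N → ℤ) (E : Fin N × ℤ → ℤ) : Prop :=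
  (∀ b, InD k lam b → 1 ≤ E b ∧ E b ≤ ((N * k : ℕ) : ℤ)) ∧
  (∀ b b', InD k lam b → InD k lam b' → E b = E b' → b = b') ∧
  (∀ v : ℤ, 1 ≤ v → v ≤ ((N * k : ℕ) : ℤ) → ∃ b, InD k lam b ∧ E b = v) ∧
  (∀ b b', InD k lam b → InD k lam b' → b.1 = b'.1 → b.2 < b'.2 → E b < E b') ∧
  (∀ b b', InD k lam b → InD k lam b' → b.1 < b'.1 → b.2 = b'.2 → E b < E b') ∧
  (∀ b, ¬ InD k lam b → E b = 0)

/-- An `n`-periodic standard tableau of shape `(k^N)` (`n = N*k`): a bijective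
filling `f` of the `N × ∞` strip by `ℤ`, strictly increasing along rows and down
columns, with `f(j, m+k) = f(j,m) + n`. -/
def IsPsyt (N k : ℕ) (f : Fin N × ℤ → ℤ) : Prop :=
  Function.Bijective f ∧
  (∀ (j : Fin N) (m m' : ℤ), m < m' → f (j, m) < f (j, m')) ∧
  (∀ (j j' : Fin N) (m : ℤ), j < j' → f (j, m) < f (j', m)) ∧
  (∀ (j : Fin N) (m : ℤ), f (j, m + (k : ℤ)) = f (j, m) + ((N * k : ℕ) : ℤ))

/-- `f` extends the tableau `T` of shape `D(λ)`: `f(j, m_N + c) = T(j,c)` for boxes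
`(j,c)` of `D(λ)`, and `f(j, m+k) = f(j,m) + n` everywhere. -/
def ExtendsTab (N k : ℕ) (lam : Fin N → ℤ) (T f : Fin N × ℤ → ℤ) : Prop :=
  (∀ b : Fin N × ℤ, InD k lam b → f (b.1, lastCoord lam b.1 + b.2) = T b) ∧
  (∀ (j : Fin N) (m : ℤ), f (j, m + (k : ℤ)) = f (j, m) + ((N * k : ℕ) : ℤ))

theorem add_mul_lt_add_mul_of_quotient_lt {n a a' q q' : ℤ} (ha : a ≤ n) (ha' : 1 ≤ a') (hn : 0 < n)
    (h : q < q') : a + n * q < a' + n * q' := by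
  nlinarith [mul_le_mul_of_nonneg_left (Int.add_one_le_iff.mpr h) hn.le]

theorem sub_mul_ediv_mem_bounds {n : ℤ} (hn : 0 < n) (x : ℤ) :
    1 ≤ x - n * ((x - 1) / n) ∧ x - n * ((x - 1) / n) ≤ n := by
  have h1 := Int.mul_ediv_add_emod (x - 1) n
  have h2 := Int.emod_nonneg (x - 1) hn.ne'
  have h3 := Int.emod_lt_of_pos (x - 1) hn
  constructor <;> linarith

theorem apply_add_mul_of_periodic {g : ℤ → ℤ} {k n : ℤ} (h : ∀ m, g (m + k) = g m + n)
    (m q : ℤ) : g (m + k * q) = g m + n * q := by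
  induction q using Int.induction_on with
  | zero => simp
  | succ i ih => rw [mul_add, mul_one, ← add_assoc, h, ih]; ring
  | pred i ih =>
    have := h (m + k * (-i - 1))
    rw [show m + k * (-(i : ℤ) - 1) + k = m + k * -i by ring, ih] at this
    linarith

theorem inD_shift_mem {N k : ℕ} (hk : 1 ≤ k) (lam : Fin N → ℤ) (j : Fin N) (m : ℤ) :
    InD k lam (j, m - lastCoord lam j - k * ((m - lam j - 1) / k)) := by
  have := sub_mul_ediv_mem_bounds (n := (k : ℤ)) (by omega) (m - lam j)
  constructor <;> simp only [gammaOf] <;> linarith [this.1, this.2]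

theorem exists_box {N k : ℕ} (hk : 1 ≤ k) (lam : Fin N → ℤ) (j : Fin N) (m : ℤ) :
    ∃ c q : ℤ, InD k lam (j, c) ∧ m = lastCoord lam j + c + k * q :=
  ⟨_, (m - lam j - 1) / k, inD_shift_mem hk lam j m, by ring⟩

theorem ExtendsTab.apply_eq {N k : ℕ} {lam : Fin N → ℤ} {T f : Fin N × ℤ → ℤ}
    (h : ExtendsTab N k lam T f) {j : Fin N} {c : ℤ} (hc : InD k lam (j, c)) (q : ℤ) :
    f (j, lastCoord lam j + c + k * q) = T (j, c) + ((N * k : ℕ) : ℤ) * q := by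
  rw [apply_add_mul_of_periodic (g := fun m => f (j, m)) (h.2 j), ← h.1 (j, c) hc]

theorem ExtendsTab.unique {N k : ℕ} (hk : 1 ≤ k) {lam : Fin N → ℤ} {T f g : Fin N × ℤ → ℤ}
    (hf : ExtendsTab N k lam T f) (hg : ExtendsTab N k lam T g) : f = g := by
  ext ⟨j, m⟩
  obtain ⟨c, q, hc, rfl⟩ := exists_box hk lam j m
  rw [hf.apply_eq hc, hg.apply_eq hc]

/-- The periodic extension of a tableau of shape `D(λ)` to the strip. -/
def periodicExtension (N k : ℕ) (lam : Fin N → ℤ) (T : Fin N × ℤ → ℤ) (b : Fin N × ℤ) : ℤ :=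
  T (b.1, b.2 - lastCoord lam b.1 - k * ((b.2 - lam b.1 - 1) / k)) +
    ((N * k : ℕ) : ℤ) * ((b.2 - lam b.1 - 1) / k)

theorem extendsTab_periodicExtension {N k : ℕ} (hk : 1 ≤ k) (lam : Fin N → ℤ)
    (T : Fin N × ℤ → ℤ) : ExtendsTab N k lam T (periodicExtension N k lam T) := by
  have hk0 : (0 : ℤ) < k := by omega
  constructor
  · rintro ⟨j, c⟩ ⟨h1, h2⟩
    simp only [gammaOf] at h1 h2
    have hq : (lastCoord lam j + c - lam j - 1) / (k : ℤ) = 0 :=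
      Int.ediv_eq_zero_of_lt (by linarith) (by linarith)
    simp [periodicExtension, hq]
  · intro j m
    have hq : (m + k - lam j - 1) / (k : ℤ) = (m - lam j - 1) / k + 1 := by
      rw [← Int.add_mul_ediv_left _ 1 hk0.ne']
      congr 1; ring
    simp only [periodicExtension, hq]
    rw [show m + (k : ℤ) - lastCoord lam j - k * ((m - lam j - 1) / k + 1) =
      m - lastCoord lam j - k * ((m - lam j - 1) / k) by ring]
    ring

theorem ExtendsTab.isPsyt {N k : ℕ} (hN : 1 ≤ N) (hk : 1 ≤ k) {lam : Fin N → ℤ}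
    {T f : Fin N × ℤ → ℤ} (hlam : Dominant lam) (hT : IsStdTabE N k lam T)
    (h : ExtendsTab N k lam T f) : IsPsyt N k f := by
  have hk0 : (0 : ℤ) < k := by omega
  have hn : (0 : ℤ) < ((N * k : ℕ) : ℤ) := by exact_mod_cast Nat.mul_pos hN hk
  obtain ⟨hran, hinj, hsurj, hrow, hcol, -⟩ := hT
  refine ⟨⟨?_, ?_⟩, ?_, ?_, h.2⟩
  · rintro ⟨j, m⟩ ⟨j', m'⟩ he
    obtain ⟨c, q, hc, rfl⟩ := exists_box hk lam j m
    obtain ⟨c', q', hc', rfl⟩ := exists_box hk lam j' m'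
    rw [h.apply_eq hc, h.apply_eq hc'] at he
    have hr := hran _ hc
    have hr' := hran _ hc'
    obtain hq | rfl | hq := lt_trichotomy q q'
    · exact absurd he (add_mul_lt_add_mul_of_quotient_lt hr.2 hr'.1 hn hq).ne
    · obtain ⟨rfl, rfl⟩ := Prod.mk.inj (hinj _ _ hc hc' (by linarith))
      rfl
    · exact absurd he (add_mul_lt_add_mul_of_quotient_lt hr'.2 hr.1 hn hq).ne'
  · intro v
    have hv := sub_mul_ediv_mem_bounds hn v
    obtain ⟨⟨j, c⟩, hc, hb⟩ := hsurj _ hv.1 hv.2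
    exact ⟨_, (h.apply_eq hc ((v - 1) / ((N * k : ℕ) : ℤ))).trans (by rw [hb]; ring)⟩
  · intro j m m' hm
    obtain ⟨c, q, hc, rfl⟩ := exists_box hk lam j m
    obtain ⟨c', q', hc', rfl⟩ := exists_box hk lam j m'
    rw [h.apply_eq hc, h.apply_eq hc']
    obtain hq | rfl | hq := lt_trichotomy q q'
    · exact add_mul_lt_add_mul_of_quotient_lt (hran _ hc).2 (hran _ hc').1 hn hq
    · have := hrow _ _ hc hc' rfl (by simp only; linarith)
      linarith
    · have := add_mul_lt_add_mul_of_quotient_lt (n := (k : ℤ)) (a := c' - gammaOf lam j)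
        (a' := c - gammaOf lam j) (by linarith [hc'.2]) (by have := hc.1; simp only at this; omega)
        hk0 hq
      linarith
  · intro j j' m hj
    obtain ⟨c, q, hc, rfl⟩ := exists_box hk lam j m
    obtain ⟨c', q', hc', he⟩ := exists_box hk lam j' (lastCoord lam j + c + k * q)
    rw [h.apply_eq hc, he, h.apply_eq hc']
    have hl : lastCoord lam j = lastCoord lam j' := rfl
    obtain hq | rfl | hq := lt_trichotomy q q'
    · exact add_mul_lt_add_mul_of_quotient_lt (hran _ hc).2 (hran _ hc').1 hn hq
    · have := hcol _ _ hc hc' hj (by simp only; linarith)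
      linarith
    · have hd := hlam j j' hj.le
      have h1 := hc.1
      have h2 := hc'.2
      simp only [gammaOf] at h1 h2
      have := add_mul_lt_add_mul_of_quotient_lt (n := (k : ℤ)) (a := c' - gammaOf lam j')
        (a' := c - gammaOf lam j) (by simp only [gammaOf]; linarith)
        (by simp only [gammaOf]; omega) hk0 hq
      simp only [gammaOf] at this
      linarith

theorem ExtendsTab.one_le_apply_iff {N k : ℕ} (hN : 1 ≤ N) (hk : 1 ≤ k) {lam : Fin N → ℤ}
    {T f : Fin N × ℤ → ℤ} (hlam : Dominant lam) (hT : IsStdTabE N k lam T)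
    (h : ExtendsTab N k lam T f) (j : Fin N) (m : ℤ) : 1 ≤ f (j, m) ↔ lam j < m := by
  have hf := h.isPsyt hN hk hlam hT
  have hmono : StrictMono fun m => f (j, m) := fun a b hab => hf.2.1 j a b hab
  have hval : ∀ m, lam j < m → m ≤ lam j + k →
      1 ≤ f (j, m) ∧ f (j, m) ≤ ((N * k : ℕ) : ℤ) := by
    intro m h1 h2
    have hc : InD k lam (j, m - lastCoord lam j) := by
      constructor <;> simp only [gammaOf] <;> linarith
    have h3 := h.1 _ hc
    have h4 := hT.1 _ hc
    simp only [add_sub_cancel] at h3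
    rwa [← h3] at h4
  constructor
  · intro h1
    by_contra! hm
    have h2 := hmono.monotone hm
    have h3 := hf.2.2.2 j (lam j)
    have h4 := (hval (lam j + k) (by omega) le_rfl).2
    linarith
  · intro hm
    exact (hval (lam j + 1) (by omega) (by omega)).1.trans
      (hmono.monotone (Int.add_one_le_iff.mpr hm))

theorem exists_last_nonpos {g : ℤ → ℤ} {k n : ℤ} (hn : 0 < n) (hg : StrictMono g)
    (h : ∀ m, g (m + k) = g m + n) : ∃ l, ∀ m, 1 ≤ g m ↔ l < m := by
  have hper := apply_add_mul_of_periodic h 0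
  have hlow : g (k * (-|g 0|)) ≤ 0 := by
    have := hper (-|g 0|)
    rw [zero_add] at this
    nlinarith [le_abs_self (g 0), abs_nonneg (g 0)]
  have hup : 1 ≤ g (k * (|g 0| + 1)) := by
    have := hper (|g 0| + 1)
    rw [zero_add] at this
    nlinarith [neg_abs_le (g 0), abs_nonneg (g 0)]
  obtain ⟨l, hl, hmax⟩ := Int.exists_greatest_of_bdd (P := fun m => g m ≤ 0)
    ⟨k * (|g 0| + 1), fun z hz => by
      by_contra! hc
      have := hg hc
      omega⟩ ⟨_, hlow⟩
  refine ⟨l, fun m => ⟨fun hm => ?_, fun hm => ?_⟩⟩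
  · by_contra! hc
    have := hg.monotone hc
    omega
  · by_contra! hc
    have := hmax m (by omega)
    omega

theorem IsPsyt.exists_extendsTab {N k : ℕ} (hN : 1 ≤ N) (hk : 1 ≤ k) {f : Fin N × ℤ → ℤ}
    (hf : IsPsyt N k f) :
    ∃ (lam : Fin N → ℤ) (T : Fin N × ℤ → ℤ),
      Dominant lam ∧ IsStdTabE N k lam T ∧ ExtendsTab N k lam T f := by
  classical
  have hn : (0 : ℤ) < ((N * k : ℕ) : ℤ) := by exact_mod_cast Nat.mul_pos hN hk
  obtain ⟨⟨hinj, hsurj⟩, hrow, hcol, hper⟩ := hf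
  choose lam hlam using fun j => exists_last_nonpos (g := fun m => f (j, m)) hn
    (fun a b hab => hrow j a b hab) (hper j)
  have hbox : ∀ j c, InD k lam (j, c) ↔
      1 ≤ f (j, lastCoord lam j + c) ∧ f (j, lastCoord lam j + c) ≤ ((N * k : ℕ) : ℤ) := by
    intro j c
    have h1 := hlam j (lastCoord lam j + c)
    have h2 := hlam j (lastCoord lam j + c - k)
    have h3 := hper j (lastCoord lam j + c - k)
    rw [sub_add_cancel] at h3
    simp only [InD, gammaOf]
    constructor
    · rintro ⟨h4, h5⟩
      refine ⟨h1.2 (by linarith), ?_⟩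
      by_contra! hc
      have := h2.1 (by linarith)
      linarith
    · rintro ⟨h4, h5⟩
      refine ⟨by linarith [h1.1 h4], ?_⟩
      by_contra! hc
      have := h2.2 (by linarith)
      linarith
  refine ⟨lam, fun b => if InD k lam b then f (b.1, lastCoord lam b.1 + b.2) else 0,
    ?_, ⟨?_, ?_, ?_, ?_, ?_, ?_⟩, ?_, hper⟩
  · intro i j hij
    obtain rfl | hij := hij.eq_or_lt
    · exact le_rfl
    by_contra! hc
    have h1 := (hlam i (lam j)).2 hc
    have h2 := hcol i j (lam j) hij
    exact lt_irrefl _ ((hlam j (lam j)).1 (by linarith))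
  · rintro ⟨j, c⟩ hb
    simp only [hb, if_true]
    exact (hbox j c).1 hb
  · rintro ⟨j, c⟩ ⟨j', c'⟩ hb hb' he
    simp only [hb, hb', if_true] at he
    obtain ⟨rfl, he⟩ := Prod.mk.inj (hinj he)
    rw [add_left_cancel he]
  · intro v h1 h2
    obtain ⟨⟨j, m⟩, rfl⟩ := hsurj v
    have hb : InD k lam (j, m - lastCoord lam j) := by
      rw [hbox, add_sub_cancel]
      exact ⟨h1, h2⟩
    exact ⟨_, hb, by simp only [hb, if_true, add_sub_cancel]⟩
  · rintro ⟨j, c⟩ ⟨j', c'⟩ hb hb' rfl hc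
    simp only [hb, hb', if_true]
    exact hrow _ _ _ (by simp only at hc; linarith)
  · rintro ⟨j, c⟩ ⟨j', c'⟩ hb hb' hj hc
    obtain rfl : c = c' := hc
    simp only [hb, hb', if_true]
    exact hcol _ _ _ hj
  · intro b hb
    simp [hb]
  · intro b hb
    simp [hb]

theorem stmt3 (N k : ℕ) (hN : 1 ≤ N) (hk : 1 ≤ k) :
    (∀ lam : Fin N → ℤ, Dominant lam → ∀ T : Fin N × ℤ → ℤ, IsStdTabE N k lam T →
      ∃! f : Fin N × ℤ → ℤ, ExtendsTab N k lam T f) ∧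
    (∃ Per : (Σ lam : Fin N → ℤ,
          {T : Fin N × ℤ → ℤ // Dominant lam ∧ IsStdTabE N k lam T}) →
          {f : Fin N × ℤ → ℤ // IsPsyt N k f},
       (∀ p, ExtendsTab N k p.1 p.2.1 (Per p).1) ∧ Function.Bijective Per) := by
  refine ⟨fun lam _ T _ => ⟨_, extendsTab_periodicExtension hk lam T,
    fun g hg => hg.unique hk (extendsTab_periodicExtension hk lam T)⟩,
    fun p => ⟨_, (extendsTab_periodicExtension hk p.1 p.2.1).isPsyt hN hk p.2.2.1 p.2.2.2⟩,
    fun p => extendsTab_periodicExtension hk p.1 p.2.1, ?_, ?_⟩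
  · rintro ⟨lam, T, hlam, hT⟩ ⟨lam', T', hlam', hT'⟩ he
    have he := Subtype.mk.inj he
    simp only at he
    have hE := extendsTab_periodicExtension hk lam T
    have hE' := extendsTab_periodicExtension hk lam' T'
    rw [← he] at hE'
    obtain rfl : lam = lam' := by
      ext j
      have h (m : ℤ) : lam j < m ↔ lam' j < m :=
        (hE.one_le_apply_iff hN hk hlam hT j m).symm.trans
          (hE'.one_le_apply_iff hN hk hlam' hT' j m)
      exact le_antisymm (not_lt.1 fun hc => lt_irrefl _ ((h _).2 hc))
        (not_lt.1 fun hc => lt_irrefl _ ((h _).1 hc))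
    obtain rfl : T = T' := by
      ext b
      by_cases hb : InD k lam b
      · rw [← hE.1 b hb, hE'.1 b hb]
      · rw [hT.2.2.2.2.2 b hb, hT'.2.2.2.2.2 b hb]
    rfl
  · rintro ⟨f, hf⟩
    obtain ⟨lam, T, hlam, hT, hE⟩ := hf.exists_extendsTab hN hk
    exact ⟨⟨lam, T, hlam, hT⟩, Subtype.ext ((extendsTab_periodicExtension hk lam T).unique hk hE)⟩
end
end

section
/- Let K be a field, let n ≥ 3 be an integer, and let s ∈ Kˣ. Define maps from (Kˣ)^n to itself: for 1 ≤ i ≤ n−1, σ_i swaps the i-th and (i+1)-st coordinates; σ_0(z_1,…,z_n) = (s^{−2n} z_n, z_2, …, z_{n−1}, s^{2n} z_1); and Π(z_1,…,z_n) = (s^{−2n+2} z_n, s² z_1, s² z_2, …, s² z_{n−1}). Then, reading all subscripts modulo n: σ_i ∘ σ_i = id for every i ∈ ℤ/nℤ; σ_i ∘ σ_{i+1} ∘ σ_i = σ_{i+1} ∘ σ_i ∘ σ_{i+1} for every i ∈ ℤ/nℤ; σ_i ∘ σ_j = σ_j ∘ σ_i whenever j ≢ i ± 1 (mod n); Π ∘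 σ_i = σ_{i+1} ∘ Π for every i ∈ ℤ/nℤ; and Π^n = id. -/
noncomputable section

/-- The SL-modified operators `σ_i` on tuples `(Kˣ)^n`, coordinates indexed by
`ZMod n` (index `c` corresponds to `z_{c+1}`).  For `i ≠ 0`, `σ_i` swaps the
`i`-th and `(i+1)`-st coordinates; `σ_0(z) = (s^{−2n} z_n, z_2, …, z_{n−1}, s^{2n} z_1)`. -/
def sigmaSL {K : Type*} [Field K] {n : ℕ} (s : Kˣ) (i : ZMod n) (z : ZMod n → Kˣ) :
    ZMod n → Kˣ :=
  fun j =>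
    if j = i - 1 then (if i = 0 then s ^ (2 * (n : ℤ)) else 1) * z i
    else if j = i then (if i = 0 then s ^ (-(2 * (n : ℤ))) else 1) * z (i - 1)
    else z j

/-- The SL-modified operator `Π(z) = (s^{−2n+2} z_n, s² z_1, s² z_2, …, s² z_{n−1})`. -/
def piSL {K : Type*} [Field K] {n : ℕ} (s : Kˣ) (z : ZMod n → Kˣ) : ZMod n → Kˣ :=
  fun j => (if j = 0 then s ^ (-(2 * (n : ℤ)) + 2) else s ^ (2 : ℤ)) * z (j - 1)

/-- The twist attached to `sigmaSL s i`: `s ^ (2 * n)` for `i = 0` and `1` otherwise. -/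
def twistSL {K : Type*} [Field K] {n : ℕ} (s : Kˣ) (i : ZMod n) : Kˣ :=
  if i = 0 then s ^ (2 * (n : ℤ)) else 1

/-- Interchange of the coordinates `i - 1` and `i`, twisted by `a` and `a⁻¹`. -/
def twistedSwap {G : Type*} [CommGroup G] {n : ℕ} (a : G) (i : ZMod n) (z : ZMod n → G) :
    ZMod n → G :=
  fun j => if j = i - 1 then a * z i else if j = i then a⁻¹ * z (i - 1) else z j

lemma sigmaSL_eq_twistedSwap {K : Type*} [Field K] {n : ℕ} (s : Kˣ) (i : ZMod n) :
    sigmaSL s i = twistedSwap (twistSL s i) i := by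
  funext z j
  by_cases hi : i = 0 <;> simp [sigmaSL, twistedSwap, twistSL, hi]

lemma piSL_apply {K : Type*} [Field K] {n : ℕ} (s : Kˣ) (z : ZMod n → Kˣ) (j : ZMod n) :
    piSL s z j = (twistSL s j)⁻¹ * s ^ 2 * z (j - 1) := by
  by_cases hj : j = 0
  · simp only [piSL, twistSL, hj, if_true, zpow_add, zpow_neg]
    norm_cast
  · simp only [piSL, twistSL, hj, if_false, inv_one, one_mul]
    norm_cast

section twistedSwap

variable {G : Type*} [CommGroup G] {n : ℕ} (a b : G)

lemma twistedSwap_comp_self (h1 : (1 : ZMod n) ≠ 0) (i : ZMod n) :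
    twistedSwap a i ∘ twistedSwap a i = id := by
  have h : i ≠ i - 1 := by simpa [eq_sub_iff_add_eq]
  funext z j
  simp only [Function.comp_apply, twistedSwap, id]
  split_ifs <;> simp_all

lemma twistedSwap_braid (h1 : (1 : ZMod n) ≠ 0) (h2 : (2 : ZMod n) ≠ 0) (i : ZMod n) :
    twistedSwap a i ∘ twistedSwap b (i + 1) ∘ twistedSwap a i
      = twistedSwap b (i + 1) ∘ twistedSwap a i ∘ twistedSwap b (i + 1) := by
  have e1 : i ≠ i - 1 := by simpa [eq_sub_iff_add_eq]
  have e2 : i + 1 ≠ i := by simpa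
  have e3 : i + 1 ≠ i - 1 := by
    simpa [eq_sub_iff_add_eq, add_assoc, one_add_one_eq_two]
  funext z j
  simp only [Function.comp_apply, twistedSwap, add_sub_cancel_right]
  by_cases c1 : j = i - 1
  · subst c1
    simp [e2, e3, e1.symm, e3.symm]
  by_cases c2 : j = i
  · subst c2
    simp [e1, e2, e3, e1.symm, e3.symm, mul_left_comm]
  by_cases c3 : j = i + 1
  · subst c3
    simp [e1, e2, e3, e1.symm, e3.symm, mul_left_comm]
  simp [c1, c2, c3]

lemma twistedSwap_comm {i j : ZMod n} (hij : i ≠ j) (h : j ≠ i + 1) (h' : i ≠ j + 1) :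
    twistedSwap a i ∘ twistedSwap b j = twistedSwap b j ∘ twistedSwap a i := by
  have e1 : i ≠ j - 1 := by grind
  have e2 : j ≠ i - 1 := by grind
  have e3 : i - 1 ≠ j - 1 := by grind
  funext z k
  simp only [Function.comp_apply, twistedSwap]
  split_ifs <;> simp_all

end twistedSwap

lemma piSL_comp_sigmaSL {K : Type*} [Field K] {n : ℕ} (h1 : (1 : ZMod n) ≠ 0)
    (s : Kˣ) (i : ZMod n) :
    piSL s ∘ sigmaSL s i = sigmaSL s (i + 1) ∘ piSL s := by
  have e2 : i + 1 ≠ i := by simpa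
  rw [sigmaSL_eq_twistedSwap, sigmaSL_eq_twistedSwap]
  funext z j
  simp only [Function.comp_apply, piSL_apply, twistedSwap, add_sub_cancel_right,
    sub_eq_iff_eq_add]
  by_cases c1 : j = i
  · subst c1
    simp [mul_comm, mul_left_comm]
  by_cases c2 : j = i + 1
  · subst c2
    simp [e2, mul_assoc, mul_comm, mul_left_comm]
  simp [c1, c2]

lemma piSL_iterate_apply {K : Type*} [Field K] {n : ℕ} (s : Kˣ) (k : ℕ) (z : ZMod n → Kˣ)
    (j : ZMod n) :
    (piSL s)^[k] z j
      = (∏ m ∈ Finset.range k, (twistSL s (j - (m : ZMod n)))⁻¹ * s ^ 2) * z (j - k) := by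
  induction k generalizing z with
  | zero => simp
  | succ k ih =>
    rw [Function.iterate_succ_apply, ih, piSL_apply, Finset.prod_range_succ, Nat.cast_succ,
      sub_add_eq_sub_sub]
    simp only [mul_assoc]

lemma ZMod.prod_range_sub {M : Type*} [CommMonoid M] {n : ℕ} [NeZero n] (f : ZMod n → M)
    (j : ZMod n) : ∏ m ∈ Finset.range n, f (j - m) = ∏ x, f x := by
  refine Finset.prod_bij' (fun m _ => j - (m : ZMod n)) (fun x _ => (j - x).val) ?_ ?_ ?_ ?_ ?_
  · simp
  · intro x _
    simpa using ZMod.val_lt (j - x)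
  · intro m hm
    simpa using ZMod.val_cast_of_lt (Finset.mem_range.mp hm)
  · simp
  · simp

lemma piSL_iterate_self {K : Type*} [Field K] {n : ℕ} [NeZero n] (s : Kˣ) :
    (piSL (K := K) (n := n) s)^[n] = id := by
  funext z j
  rw [piSL_iterate_apply, ZMod.prod_range_sub (fun x => (twistSL s x)⁻¹ * s ^ 2)]
  have h : (∏ x : ZMod n, twistSL s x) = s ^ (2 * n) := by
    simp only [twistSL, Finset.prod_ite_eq', Finset.mem_univ, if_true]
    norm_cast
  simp [Finset.prod_mul_distrib, h, ZMod.card, pow_mul]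

theorem stmt5 (K : Type*) [Field K] (n : ℕ) (hn : 3 ≤ n) (s : Kˣ) :
    (∀ i : ZMod n, sigmaSL s i ∘ sigmaSL s i = id) ∧
    (∀ i : ZMod n,
      sigmaSL s i ∘ sigmaSL s (i + 1) ∘ sigmaSL s i
        = sigmaSL s (i + 1) ∘ sigmaSL s i ∘ sigmaSL s (i + 1)) ∧
    (∀ i j : ZMod n, j ≠ i + 1 → i ≠ j + 1 →
      sigmaSL s i ∘ sigmaSL s j = sigmaSL s j ∘ sigmaSL s i) ∧
    (∀ i : ZMod n, piSL s ∘ sigmaSL s i = sigmaSL s (i + 1) ∘ piSL s) ∧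
    ((piSL (K := K) (n := n) s)^[n] = id) := by
  have : NeZero n := ⟨by omega⟩
  have h1 : (1 : ZMod n) ≠ 0 := by
    have : Fact (1 < n) := ⟨by omega⟩
    exact one_ne_zero
  have h2 : (2 : ZMod n) ≠ 0 := by
    intro h
    have h' : ((2 : ℕ) : ZMod n) = 0 := by exact_mod_cast h
    rw [ZMod.natCast_eq_zero_iff] at h'
    exact absurd (Nat.le_of_dvd two_pos h') (by omega)
  refine ⟨fun i => ?_, fun i => ?_, fun i j h h' => ?_, piSL_comp_sigmaSL h1 s,
    piSL_iterate_self s⟩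
  · rw [sigmaSL_eq_twistedSwap]
    exact twistedSwap_comp_self _ h1 i
  · simp only [sigmaSL_eq_twistedSwap]
    exact twistedSwap_braid _ _ h1 h2 i
  · rcases eq_or_ne i j with rfl | hij
    · rfl
    · simp only [sigmaSL_eq_twistedSwap]
      exact twistedSwap_comm _ _ hij h h'
end
end

section
/- Let n ≥ 2. In the elliptic braid group B_{n+1}^{Ell}, presented by generators X_1, …, X_{n+1}, Y_1, …, Y_{n+1}, T_1, …, T_n with the relations listed in the context, the following identity holds: Y_n · (X_1 X_2 ⋯ X_n) = (X_1 X_2 ⋯ X_n) · T_n² · Y_n. -/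
noncomputable section

/-- Generators of the elliptic braid group `B_{n+1}^{Ell}`:
`X_1, …, X_{n+1}`, `Y_1, …, Y_{n+1}`, `T_1, …, T_n` (all 1-indexed;
a generator with 1-indexed subscript `i` corresponds to the `Fin` index `i - 1`). -/
def EGen (n : ℕ) : Type := Fin (n + 1) ⊕ (Fin (n + 1) ⊕ Fin n)

def fX {n : ℕ} (i : Fin (n + 1)) : FreeGroup (EGen n) := FreeGroup.of (Sum.inl i)
def fY {n : ℕ} (i : Fin (n + 1)) : FreeGroup (EGen n) := FreeGroup.of (Sum.inr (Sum.inl i))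
def fT {n : ℕ} (i : Fin n) : FreeGroup (EGen n) := FreeGroup.of (Sum.inr (Sum.inr i))

/-- The defining relations of the elliptic braid group `B_{n+1}^{Ell}`. -/
def ellRels (n : ℕ) : Set (FreeGroup (EGen n)) :=
  {r | (∃ i j, r = fX i * fX j * (fX j * fX i)⁻¹) ∨
       (∃ i j, r = fY i * fY j * (fY j * fY i)⁻¹) ∨
       (∃ i j : Fin n, (j : ℕ) = (i : ℕ) + 1 ∧
          r = fT i * fT j * fT i * (fT j * fT i * fT j)⁻¹) ∨
       (∃ i j : Fin n, ((i : ℕ) + 2 ≤ (j : ℕ) ∨ (j : ℕ) + 2 ≤ (i : ℕ)) ∧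
          r = fT i * fT j * (fT j * fT i)⁻¹) ∨
       (∃ i : Fin n, r = fT i * fX i.castSucc * fT i * (fX i.succ)⁻¹) ∨
       (∃ i : Fin n, r = fT i * fY i.castSucc * fT i * (fY i.succ)⁻¹) ∨
       (∃ (a b : Fin (n + 1)) (c : Fin n), (a : ℕ) = 0 ∧ (b : ℕ) = 1 ∧ (c : ℕ) = 0 ∧
          r = fX a * fY b * (fY b * fX a * fT c * fT c)⁻¹) ∨
       (∃ j : Fin (n + 1),
          r = (List.ofFn (fun i : Fin (n + 1) => fX i)).prod * fY j *
                (fY j * (List.ofFn (fun i : Fin (n + 1) => fX i)).prod)⁻¹) ∨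
       (∃ (i : Fin (n + 1)) (j : Fin n), ((i : ℕ) + 2 ≤ (j : ℕ) ∨ (j : ℕ) + 2 ≤ (i : ℕ)) ∧
          r = fX i * fT j * (fT j * fX i)⁻¹) ∨
       (∃ (i : Fin (n + 1)) (j : Fin n), ((i : ℕ) + 2 ≤ (j : ℕ) ∨ (j : ℕ) + 2 ≤ (i : ℕ)) ∧
          r = fY i * fT j * (fT j * fY i)⁻¹)}

/-- The elliptic braid group `B_{n+1}^{Ell}`, as a presented group. -/
abbrev EB (n : ℕ) := PresentedGroup (ellRels n)

def Xg {n : ℕ} (i : Fin (n + 1)) : EB n := PresentedGroup.of (Sum.inl i)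
def Yg {n : ℕ} (i : Fin (n + 1)) : EB n := PresentedGroup.of (Sum.inr (Sum.inl i))
def Tg {n : ℕ} (i : Fin n) : EB n := PresentedGroup.of (Sum.inr (Sum.inr i))

section BraidRelations

variable {G : Type*} [Group G]

/-- If `x` and `z` are linked by `s t x t s = z`, where `s` and `t` satisfy the braid relation and
`z` commutes with `t`, then `x` commutes with `s`. -/
theorem commute_of_braid {s t x z : G} (hb : t * s * t = s * t * s)
    (hz : s * (t * x * t) * s = z) (h : Commute z t) : Commute x s := by
  have h1 : s * t * (x * s) * (t * s) = s * t * (s * x) * (t * s) := by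
    calc s * t * (x * s) * (t * s) = s * t * x * (s * t * s) := by group
      _ = s * (t * x * t) * s * t := by rw [← hb]; group
      _ = t * (s * (t * x * t) * s) := by rw [hz, h.eq]
      _ = (t * s * t) * x * t * s := by group
      _ = s * t * (s * x) * (t * s) := by rw [hb]; group
  exact mul_left_cancel (mul_right_cancel h1)

/-- The base case of the cross relation between `T x T` and `y`. -/
theorem cross_relation_of_mul {t x y : G} (h : x * (t * y * t) = t * y * t * x * t * t) :
    t * x * t * y = t * t * y * (t * x * t) := by
  apply mul_right_cancel (b := t)
  calc t * x * t * y * t = t * (x * (t * y * t)) := by group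
    _ = t * t * y * (t * x * t) * t := by rw [h]; group

/-- The cross relation is transported along a braid relation. -/
theorem cross_relation_step {s t x y : G} (hb : t * s * t = s * t * s) (hy : Commute y s)
    (hx : Commute (s * x * s) t) (h : x * y = t * t * y * x) :
    s * x * s * (t * y * t) = s * s * (t * y * t) * (s * x * s) := by
  calc s * x * s * (t * y * t) = (s * x * s * t) * y * t := by group
    _ = t * s * x * (s * y) * t := by rw [hx.eq]; group
    _ = t * s * (x * y) * s * t := by rw [← hy.eq]; group
    _ = (t * s * t) * t * y * x * s * t := by rw [h]; group
    _ = (s * t * s) * t * y * x * s * t := by rw [hb]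
    _ = s * (t * s * t) * y * x * s * t := by group
    _ = s * s * t * (s * y) * x * s * t := by rw [hb]; group
    _ = s * s * t * y * (s * x * s * t) := by rw [← hy.eq]; group
    _ = s * s * (t * y * t) * (s * x * s) := by rw [hx.eq]; group

end BraidRelations

section EllipticBraidGroup

variable {n : ℕ}

theorem mk_eq_of_mem_ellRels {a b : FreeGroup (EGen n)} (h : a * b⁻¹ ∈ ellRels n) :
    PresentedGroup.mk (ellRels n) a = PresentedGroup.mk (ellRels n) b := by
  have := PresentedGroup.one_of_mem h
  rwa [map_mul, map_inv, mul_inv_eq_one] at this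

theorem Tg_braid (i j : Fin n) (h : (j : ℕ) = i + 1) :
    Tg i * Tg j * Tg i = Tg j * Tg i * Tg j :=
  mk_eq_of_mem_ellRels (a := fT i * fT j * fT i) (b := fT j * fT i * fT j)
    (.inr <| .inr <| .inl ⟨i, j, h, rfl⟩)

theorem Tg_mul_Xg_mul_Tg (i : Fin n) : Tg i * Xg i.castSucc * Tg i = Xg i.succ :=
  mk_eq_of_mem_ellRels (a := fT i * fX i.castSucc * fT i) (b := fX i.succ)
    (.inr <| .inr <| .inr <| .inr <| .inl ⟨i, rfl⟩)

theorem Tg_mul_Yg_mul_Tg (i : Fin n) : Tg i * Yg i.castSucc * Tg i = Yg i.succ :=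
  mk_eq_of_mem_ellRels (a := fT i * fY i.castSucc * fT i) (b := fY i.succ)
    (.inr <| .inr <| .inr <| .inr <| .inr <| .inl ⟨i, rfl⟩)

theorem Xg_mul_Yg (a b : Fin (n + 1)) (c : Fin n) (ha : (a : ℕ) = 0) (hb : (b : ℕ) = 1)
    (hc : (c : ℕ) = 0) : Xg a * Yg b = Yg b * Xg a * Tg c * Tg c :=
  mk_eq_of_mem_ellRels (a := fX a * fY b) (b := fY b * fX a * fT c * fT c)
    (.inr <| .inr <| .inr <| .inr <| .inr <| .inr <| .inl ⟨a, b, c, ha, hb, hc, rfl⟩)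

theorem commute_prod_Xg_Yg (j : Fin (n + 1)) :
    Commute (List.ofFn (fun i : Fin (n + 1) => Xg (n := n) i)).prod (Yg j) := by
  have h := mk_eq_of_mem_ellRels
    (a := (List.ofFn (fun i : Fin (n + 1) => fX i)).prod * fY j)
    (b := fY j * (List.ofFn (fun i : Fin (n + 1) => fX i)).prod)
    (.inr <| .inr <| .inr <| .inr <| .inr <| .inr <| .inr <| .inl ⟨j, rfl⟩)
  rw [map_mul, map_mul, map_list_prod, List.map_ofFn] at h
  exact h

theorem commute_Xg_Tg (i : Fin (n + 1)) (j : Fin n)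
    (h : (i : ℕ) + 2 ≤ j ∨ (j : ℕ) + 2 ≤ i) : Commute (Xg i) (Tg j) :=
  mk_eq_of_mem_ellRels (a := fX i * fT j) (b := fT j * fX i)
    (.inr <| .inr <| .inr <| .inr <| .inr <| .inr <| .inr <| .inr <| .inl ⟨i, j, h, rfl⟩)

theorem commute_Yg_Tg (i : Fin (n + 1)) (j : Fin n)
    (h : (i : ℕ) + 2 ≤ j ∨ (j : ℕ) + 2 ≤ i) : Commute (Yg i) (Tg j) :=
  mk_eq_of_mem_ellRels (a := fY i * fT j) (b := fT j * fY i)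
    (.inr <| .inr <| .inr <| .inr <| .inr <| .inr <| .inr <| .inr <| .inr ⟨i, j, h, rfl⟩)

/-- `Y_i` commutes with `T_{i+1}`; this adjacent case is not among the defining relations. -/
theorem commute_Yg_castSucc_Tg (i j : Fin n) (h : (j : ℕ) = i + 1) :
    Commute (Yg i.castSucc) (Tg j) := by
  have hij : j.castSucc = i.succ := Fin.ext h
  refine commute_of_braid (Tg_braid i j h) (z := Yg j.succ) ?_
    (commute_Yg_Tg _ _ (.inr (by simp [h])))
  rw [Tg_mul_Yg_mul_Tg, ← hij, Tg_mul_Yg_mul_Tg]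

/-- `X_{i+1} Y_i = T_i² Y_i X_{i+1}`. -/
theorem Xg_succ_mul_Yg_castSucc (i : Fin n) :
    Xg i.succ * Yg i.castSucc = Tg i * Tg i * Yg i.castSucc * Xg i.succ := by
  obtain ⟨k, hk⟩ := i
  induction k with
  | zero =>
    rw [← Tg_mul_Xg_mul_Tg]
    apply cross_relation_of_mul
    rw [Tg_mul_Yg_mul_Tg]
    exact Xg_mul_Yg _ _ _ rfl rfl rfl
  | succ k ih =>
    have hk' : k < n := by omega
    have hij : (⟨k + 1, hk⟩ : Fin n).castSucc = (⟨k, hk'⟩ : Fin n).succ := rfl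
    rw [← Tg_mul_Xg_mul_Tg, hij, ← Tg_mul_Yg_mul_Tg ⟨k, hk'⟩]
    refine cross_relation_step (Tg_braid _ _ rfl) (commute_Yg_castSucc_Tg _ _ rfl) ?_ (ih hk')
    rw [← hij, Tg_mul_Xg_mul_Tg]
    exact commute_Xg_Tg _ _ (.inr le_rfl)

end EllipticBraidGroup

/-- In `B_{n+1}^{Ell}`: `Y_n (X_1 ⋯ X_n) = (X_1 ⋯ X_n) T_n² Y_n`. -/
theorem stmt7 (n : ℕ) (hn : 2 ≤ n) :
    Yg (n := n) ⟨n - 1, by omega⟩ *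
        (List.ofFn (fun i : Fin n => Xg i.castSucc)).prod
      = (List.ofFn (fun i : Fin n => Xg i.castSucc)).prod *
          (Tg (n := n) ⟨n - 1, by omega⟩ * Tg (n := n) ⟨n - 1, by omega⟩) *
          Yg (n := n) ⟨n - 1, by omega⟩ := by
  set P := (List.ofFn (fun i : Fin n => Xg (n := n) i.castSucc)).prod
  let l : Fin n := ⟨n - 1, by omega⟩
  change Yg l.castSucc * P = P * (Tg l * Tg l) * Yg l.castSucc
  have hl : l.succ = Fin.last n := Fin.ext (by simp [l]; omega)
  have hP : P * Xg l.succ * Yg l.castSucc = Yg l.castSucc * (P * Xg l.succ) := by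
    have h := (commute_prod_Xg_Yg (n := n) l.castSucc).eq
    rwa [List.ofFn_succ', List.concat_eq_append, List.prod_append, List.prod_singleton,
      ← hl] at h
  apply mul_right_cancel (b := Xg l.succ)
  rw [mul_assoc, ← hP, mul_assoc, Xg_succ_mul_Yg_castSucc]
  group
end
end

section
/- Let K be a field, n ≥ 2 an integer, and q, t ∈ Kˣ. In the double affine Hecke algebra H_{q,t}(GL_n), define X_1 = π T_{n−1}⁻¹ T_{n−2}⁻¹ ⋯ T_1⁻¹ and X_{i+1} = T_i X_i T_i for i = 1, …, n−1. Then the elements X_1, …, X_n pairwise commute: X_i X_j = X_j X_i for all 1 ≤ i, j ≤ n. -/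
noncomputable section

/-- Generators of the double affine Hecke algebra `H_{q,t}(GL_n)`:
`T_i` for `i ∈ ℤ/nℤ`, `π` and its inverse, and `Y_1, …, Y_n` and their inverses
(the generator `Y` with `Fin` index `a` corresponds to `Y_{a+1}`). -/
inductive DGen (n : ℕ) : Type where
  | T : ZMod n → DGen n
  | P : DGen n
  | Pinv : DGen n
  | Y : Fin n → DGen n
  | Yinv : Fin n → DGen n

abbrev FA (K : Type*) [Field K] (n : ℕ) := FreeAlgebra K (DGen n)

def gT (K : Type*) [Field K] (n : ℕ) (i : ZMod n) : FA K n := FreeAlgebra.ι K (DGen.T i)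
def gP (K : Type*) [Field K] (n : ℕ) : FA K n := FreeAlgebra.ι K DGen.P
def gPinv (K : Type*) [Field K] (n : ℕ) : FA K n := FreeAlgebra.ι K DGen.Pinv
def gY (K : Type*) [Field K] (n : ℕ) (i : Fin n) : FA K n := FreeAlgebra.ι K (DGen.Y i)
def gYinv (K : Type*) [Field K] (n : ℕ) (i : Fin n) : FA K n := FreeAlgebra.ι K (DGen.Yinv i)
def sc (K : Type*) [Field K] (n : ℕ) (c : K) : FA K n := algebraMap K (FA K n) c

/-- The defining relations of the double affine Hecke algebra `H_{q,t}(GL_n)`. -/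
inductive DahaRel (K : Type*) [Field K] (n : ℕ) (q t : Kˣ) : FA K n → FA K n → Prop where
  | hecke (i : ZMod n) :
      DahaRel K n q t
        ((gT K n i - sc K n (t : K)) * (gT K n i + sc K n ((t⁻¹ : Kˣ) : K))) 0
  | braid (i : ZMod n) :
      DahaRel K n q t (gT K n i * gT K n (i + 1) * gT K n i)
        (gT K n (i + 1) * gT K n i * gT K n (i + 1))
  | tcomm (i j : ZMod n) (h1 : j ≠ i + 1) (h2 : i ≠ j + 1) :
      DahaRel K n q t (gT K n i * gT K n j) (gT K n j * gT K n i)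
  | pPinv : DahaRel K n q t (gP K n * gPinv K n) 1
  | pinvP : DahaRel K n q t (gPinv K n * gP K n) 1
  | ycomm (i j : Fin n) : DahaRel K n q t (gY K n i * gY K n j) (gY K n j * gY K n i)
  | yYinv (i : Fin n) : DahaRel K n q t (gY K n i * gYinv K n i) 1
  | yinvY (i : Fin n) : DahaRel K n q t (gYinv K n i * gY K n i) 1
  | ptp (i : ZMod n) :
      DahaRel K n q t (gP K n * gT K n i * gPinv K n) (gT K n (i + 1))
  | tyt (a b : Fin n) (h : (b : ℕ) = (a : ℕ) + 1) :
      DahaRel K n q t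
        (gT K n (((a : ℕ) + 1 : ℕ) : ZMod n) * gY K n a * gT K n (((a : ℕ) + 1 : ℕ) : ZMod n))
        (gY K n b)
  | t0yt0 (a b : Fin n) (ha : (a : ℕ) = n - 1) (hb : (b : ℕ) = 0) :
      DahaRel K n q t (gT K n 0 * gY K n a * gT K n 0)
        (sc K n ((q⁻¹ : Kˣ) : K) * gY K n b)
  | tycomm (i : ZMod n) (a : Fin n)
      (h1 : (((a : ℕ) + 1 : ℕ) : ZMod n) ≠ i) (h2 : (((a : ℕ) + 1 : ℕ) : ZMod n) ≠ i + 1) :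
      DahaRel K n q t (gT K n i * gY K n a) (gY K n a * gT K n i)
  | pyp (a b : Fin n) (h : (b : ℕ) = (a : ℕ) + 1) :
      DahaRel K n q t (gP K n * gY K n a * gPinv K n) (gY K n b)
  | pynp (a b : Fin n) (ha : (a : ℕ) = n - 1) (hb : (b : ℕ) = 0) :
      DahaRel K n q t (gP K n * gY K n a * gPinv K n)
        (sc K n ((q⁻¹ : Kˣ) : K) * gY K n b)

/-- The double affine Hecke algebra `H_{q,t}(GL_n)`. -/
abbrev DAHA (K : Type*) [Field K] (n : ℕ) (q t : Kˣ) := RingQuot (DahaRel K n q t)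

def Telt (K : Type*) [Field K] (n : ℕ) (q t : Kˣ) (i : ZMod n) : DAHA K n q t :=
  RingQuot.mkAlgHom K (DahaRel K n q t) (gT K n i)
def Pelt (K : Type*) [Field K] (n : ℕ) (q t : Kˣ) : DAHA K n q t :=
  RingQuot.mkAlgHom K (DahaRel K n q t) (gP K n)
def Pinvelt (K : Type*) [Field K] (n : ℕ) (q t : Kˣ) : DAHA K n q t :=
  RingQuot.mkAlgHom K (DahaRel K n q t) (gPinv K n)
def Yelt (K : Type*) [Field K] (n : ℕ) (q t : Kˣ) (i : Fin n) : DAHA K n q t :=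
  RingQuot.mkAlgHom K (DahaRel K n q t) (gY K n i)
def Yinvelt (K : Type*) [Field K] (n : ℕ) (q t : Kˣ) (i : Fin n) : DAHA K n q t :=
  RingQuot.mkAlgHom K (DahaRel K n q t) (gYinv K n i)

section BraidGroup

variable {G : Type*} [Group G]

/-- The partial products `s 0 * s 1 * ⋯ * s (k - 1)`. -/
def ascProd (s : ℕ → G) : ℕ → G
  | 0 => 1
  | k + 1 => ascProd s k * s k

/-- The Jucys–Murphy type sequence `x 0 = x₀`, `x (i + 1) = s i * x i * s i`. -/
def jmSeq (s : ℕ → G) (x₀ : G) : ℕ → G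
  | 0 => x₀
  | i + 1 => s i * jmSeq s x₀ i * s i

theorem ascProd_mul_of_braid {m : ℕ} {s : ℕ → G}
    (braid : ∀ i, i + 1 < m → s i * s (i + 1) * s i = s (i + 1) * s i * s (i + 1))
    (comm : ∀ i j, i + 1 < j → j < m → Commute (s i) (s j)) {k : ℕ} (hk : k ≤ m) :
    ∀ i, i + 1 < k → ascProd s k * s i = s (i + 1) * ascProd s k := by
  have far : ∀ k j, k < j → j < m → Commute (ascProd s k) (s j) := by
    intro k
    induction k with
    | zero => intro j _ _; exact Commute.one_left _
    | succ k ih => intro j h1 h2; exact (ih j (by omega) h2).mul_left (comm k j h1 h2)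
  induction k with
  | zero => intro i hi; omega
  | succ k ih =>
    intro i hi
    rcases Nat.lt_or_ge (i + 1) k with h | h
    · have h1 := ih (by omega) i h
      have h2 := (comm i k h (by omega)).eq
      simp only [ascProd]
      rw [mul_assoc, ← h2, ← mul_assoc, h1, mul_assoc]
    · obtain rfl : k = i + 1 := by omega
      have h1 := (far i (i + 1) (by omega) (by omega)).eq
      have h2 := braid i (by omega)
      simp only [ascProd]
      calc ascProd s i * s i * s (i + 1) * s i
          = ascProd s i * (s i * s (i + 1) * s i) := by simp only [mul_assoc]
        _ = (ascProd s i * s (i + 1)) * (s i * s (i + 1)) := by rw [h2]; simp only [mul_assoc]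
        _ = _ := by rw [h1]; simp only [mul_assoc]

theorem mul_ascProd_of_shift {m : ℕ} {s : ℕ → G} {g : G}
    (hg : ∀ i, i + 1 < m → g * s i = s (i + 1) * g) {k : ℕ} (hk : k < m) :
    g * ascProd s k = (s 0)⁻¹ * ascProd s (k + 1) * g := by
  induction k with
  | zero => simp [ascProd]
  | succ k ih =>
    rw [ascProd, ← mul_assoc, ih (by omega), mul_assoc, hg k hk, ascProd.eq_2 s (k + 1)]
    simp only [mul_assoc]

theorem commute_jmSeq_of_braid {m : ℕ} {s : ℕ → G} {x₀ : G}
    (braid : ∀ i, i + 1 < m → s i * s (i + 1) * s i = s (i + 1) * s i * s (i + 1))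
    (comm : ∀ i j, i + 1 < j → j < m → Commute (s i) (s j))
    (hx : ∀ j, 0 < j → j < m → Commute (s j) x₀)
    (hx0 : 0 < m → Commute x₀ (s 0 * x₀ * s 0)) {i j : ℕ} (hij : i < j) (hj : j ≤ m) :
    Commute (jmSeq s x₀ i) (jmSeq s x₀ j) := by
  have above : ∀ i j, i < j → j < m → Commute (s j) (jmSeq s x₀ i) := by
    intro i
    induction i with
    | zero => exact hx
    | succ i ih =>
      intro j h1 h2
      have h := (comm i j h1 h2).symm
      exact (h.mul_right (ih j (by omega) h2)).mul_right h
  have below : ∀ i j, j + 2 ≤ i → i ≤ m → Commute (s j) (jmSeq s x₀ i) := by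
    intro i j h
    induction i, h using Nat.le_induction with
    | base =>
      intro hm
      have h1 := braid j (by omega)
      have h2 := (above j (j + 1) (by omega) (by omega)).eq
      change s j * (s (j + 1) * (s j * jmSeq s x₀ j * s j) * s (j + 1)) =
        s (j + 1) * (s j * jmSeq s x₀ j * s j) * s (j + 1) * s j
      calc _ = (s j * s (j + 1) * s j) * jmSeq s x₀ j * s j * s (j + 1) := by
            simp only [mul_assoc]
        _ = s (j + 1) * s j * (s (j + 1) * jmSeq s x₀ j) * s j * s (j + 1) := by
            rw [h1]; simp only [mul_assoc]
        _ = s (j + 1) * s j * jmSeq s x₀ j * (s (j + 1) * s j * s (j + 1)) := by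
            rw [h2]; simp only [mul_assoc]
        _ = _ := by rw [← h1]; simp only [mul_assoc]
    | succ i hi ih =>
      intro hm
      have h := comm j i (by omega) (by omega)
      exact (h.mul_right (ih (by omega))).mul_right h
  induction i with
  | zero =>
    induction j, hij using Nat.le_induction with
    | base => exact hx0 (by omega)
    | succ j h ih =>
      have h' := (hx j h (by omega)).symm
      exact (h'.mul_right (ih (by omega))).mul_right h'
  | succ i ih =>
    have h := below j i (by omega) hj
    exact (h.mul_left (ih (by omega))).mul_left h

theorem commute_jmSeq_of_affine {m : ℕ} {s : ℕ → G} {p : G}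
    (braid : ∀ i, i + 1 < m → s i * s (i + 1) * s i = s (i + 1) * s i * s (i + 1))
    (comm : ∀ i j, i + 1 < j → j < m → Commute (s i) (s j))
    (hp : ∀ i, i + 1 < m → p * s i = s (i + 1) * p)
    (hp2 : p * p * s (m - 1) = s 0 * (p * p)) {i j : ℕ} (hi : i ≤ m) (hj : j ≤ m) :
    Commute (jmSeq s (p * (ascProd s m)⁻¹) i) (jmSeq s (p * (ascProd s m)⁻¹) j) := by
  have hD := ascProd_mul_of_braid braid comm le_rfl
  have key {i j : ℕ} (hij : i < j) (hj : j ≤ m) :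
      Commute (jmSeq s (p * (ascProd s m)⁻¹) i) (jmSeq s (p * (ascProd s m)⁻¹) j) := by
    refine commute_jmSeq_of_braid braid comm ?_ ?_ hij hj
    · intro j h0 hj
      obtain ⟨j, rfl⟩ : ∃ k, j = k + 1 := ⟨j - 1, by omega⟩
      have h2 : s j * (ascProd s m)⁻¹ = (ascProd s m)⁻¹ * s (j + 1) := by
        rw [mul_inv_eq_iff_eq_mul, mul_assoc, ← hD j hj, inv_mul_cancel_left]
      change s (j + 1) * (p * (ascProd s m)⁻¹) = p * (ascProd s m)⁻¹ * s (j + 1)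
      rw [← mul_assoc, ← hp j hj, mul_assoc, h2, mul_assoc]
    · intro hm
      obtain ⟨k, rfl⟩ : ∃ k, m = k + 1 := ⟨m - 1, by omega⟩
      have h1 := mul_ascProd_of_shift hp k.lt_succ_self
      have h2 := mul_ascProd_of_shift hD k.lt_succ_self
      set D := ascProd s (k + 1)
      set V := ascProd s k
      have hDV : D = V * s k := rfl
      rw [Nat.add_sub_cancel] at hp2
      have hEV : (s 0)⁻¹ * D * V * s k = s 0 * ((s 0)⁻¹ * D * V) := by
        rw [mul_assoc _ V, ← hDV, ← h2]
        group
      have hpE : p * (D⁻¹ * s 0) * (p * (D⁻¹ * s 0)) = p * p * ((s 0)⁻¹ * D * V)⁻¹ := by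
        have h3 : D⁻¹ * s 0 * p = p * V⁻¹ := by
          rw [eq_mul_inv_iff_mul_eq, mul_assoc, h1]
          group
        calc _ = p * (D⁻¹ * s 0 * p) * (D⁻¹ * s 0) := by simp only [mul_assoc]
          _ = _ := by rw [h3]; group
      have hW : s 0 * (p * p * ((s 0)⁻¹ * D * V)⁻¹) = p * p * ((s 0)⁻¹ * D * V)⁻¹ * s 0 := by
        have h4 : s k * ((s 0)⁻¹ * D * V)⁻¹ = ((s 0)⁻¹ * D * V)⁻¹ * s 0 := by
          rw [mul_inv_eq_iff_eq_mul, mul_assoc, ← hEV, inv_mul_cancel_left]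
        rw [← mul_assoc, ← hp2, mul_assoc (p * p), h4, ← mul_assoc]
      rw [← hpE] at hW
      change p * D⁻¹ * (s 0 * (p * D⁻¹) * s 0) = s 0 * (p * D⁻¹) * s 0 * (p * D⁻¹)
      apply mul_right_cancel (b := s 0)
      calc _ = p * (D⁻¹ * s 0) * (p * (D⁻¹ * s 0)) * s 0 := by simp only [mul_assoc]
        _ = _ := by rw [← hW]; simp only [mul_assoc]
  rcases lt_trichotomy i j with h | rfl | h
  · exact key h hj
  · exact Commute.refl _
  · exact (key h hi).symm

end BraidGroup

theorem ofFn_prod_eq_inv_ascProd {M : Type*} [Monoid M] (s : ℕ → Mˣ) (f : ℕ → M) (m : ℕ)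
    (hf : ∀ i, f (i + 1) = ↑(s i)⁻¹) :
    (List.ofFn (fun i : Fin m => f (m - (i : ℕ)))).prod = ↑(ascProd s m)⁻¹ := by
  induction m with
  | zero => simp [ascProd]
  | succ m ih =>
    rw [List.ofFn_succ, List.prod_cons]
    simp only [Fin.val_zero, Fin.val_succ, Nat.add_sub_add_right, Nat.sub_zero]
    rw [ih, hf, ascProd, mul_inv_rev, Units.val_mul]

section DahaRelations

variable {K : Type*} [Field K] {n : ℕ} {q t : Kˣ}

theorem Telt_braid (i : ZMod n) :
    Telt K n q t i * Telt K n q t (i + 1) * Telt K n q t i =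
      Telt K n q t (i + 1) * Telt K n q t i * Telt K n q t (i + 1) := by
  simpa only [map_mul, Telt, Pelt, Pinvelt] using RingQuot.mkAlgHom_rel K (DahaRel.braid (q := q) (t := t) i)

theorem Telt_comm {i j : ZMod n} (h1 : j ≠ i + 1) (h2 : i ≠ j + 1) :
    Telt K n q t i * Telt K n q t j = Telt K n q t j * Telt K n q t i := by
  simpa only [map_mul, Telt, Pelt, Pinvelt] using RingQuot.mkAlgHom_rel K (DahaRel.tcomm (q := q) (t := t) i j h1 h2)

theorem Pelt_mul_Pinvelt : Pelt K n q t * Pinvelt K n q t = 1 := by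
  simpa only [map_mul, map_one, Pelt, Pinvelt] using RingQuot.mkAlgHom_rel K (DahaRel.pPinv (q := q) (t := t))

theorem Pinvelt_mul_Pelt : Pinvelt K n q t * Pelt K n q t = 1 := by
  simpa only [map_mul, map_one, Pelt, Pinvelt] using RingQuot.mkAlgHom_rel K (DahaRel.pinvP (q := q) (t := t))

theorem Pelt_mul_Telt (i : ZMod n) :
    Pelt K n q t * Telt K n q t i = Telt K n q t (i + 1) * Pelt K n q t := by
  have h : Pelt K n q t * Telt K n q t i * Pinvelt K n q t = Telt K n q t (i + 1) := by
    simpa only [map_mul, Telt, Pelt, Pinvelt] using RingQuot.mkAlgHom_rel K (DahaRel.ptp (q := q) (t := t) i)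
  rw [← h, mul_assoc _ _ (Pelt K n q t), Pinvelt_mul_Pelt, mul_one]

end DahaRelations

/-- Defining `X_1 = π T_{n−1}⁻¹ ⋯ T_1⁻¹` and `X_{i+1} = T_i X_i T_i`
(here `X` has `Fin` index `a` corresponding to `X_{a+1}`, and `Tinv i` is any
two-sided inverse of `T_i`), the elements `X_1, …, X_n` pairwise commute. -/
theorem stmt8 (K : Type*) [Field K] (n : ℕ) (hn : 2 ≤ n) (q t : Kˣ)
    (Tinv : ZMod n → DAHA K n q t)
    (hTinv : ∀ i : ZMod n, Telt K n q t i * Tinv i = 1 ∧ Tinv i * Telt K n q t i = 1)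
    (X : Fin n → DAHA K n q t)
    (hX1 : X ⟨0, by omega⟩
      = Pelt K n q t *
          (List.ofFn (fun i : Fin (n - 1) => Tinv ((n - 1 - (i : ℕ) : ℕ) : ZMod n))).prod)
    (hXs : ∀ (i : ℕ) (h1 : 1 ≤ i) (h2 : i < n),
      X ⟨i, h2⟩ = Telt K n q t ((i : ℕ) : ZMod n) * X ⟨i - 1, by omega⟩ *
          Telt K n q t ((i : ℕ) : ZMod n)) :
    ∀ i j : Fin n, X i * X j = X j * X i := by
  let s : ℕ → (DAHA K n q t)ˣ := fun i =>
    ⟨Telt K n q t ((i + 1 : ℕ) : ZMod n), Tinv ((i + 1 : ℕ) : ZMod n), (hTinv _).1, (hTinv _).2⟩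
  let p : (DAHA K n q t)ˣ :=
    ⟨Pelt K n q t, Pinvelt K n q t, Pelt_mul_Pinvelt, Pinvelt_mul_Pelt⟩
  have braid : ∀ i, i + 1 < n - 1 → s i * s (i + 1) * s i = s (i + 1) * s i * s (i + 1) := by
    intro i _
    ext
    have h := Telt_braid (q := q) (t := t) ((i + 1 : ℕ) : ZMod n)
    rw [← Nat.cast_succ] at h
    exact h
  have comm : ∀ i j, i + 1 < j → j < n - 1 → Commute (s i) (s j) := by
    intro i j hij hj
    refine Units.ext (Telt_comm ?_ ?_)
    · rw [← Nat.cast_succ, Ne, ZMod.natCast_eq_natCast_iff', Nat.mod_eq_of_lt (by omega),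
        Nat.mod_eq_of_lt (by omega)]
      omega
    · rw [← Nat.cast_succ, Ne, ZMod.natCast_eq_natCast_iff', Nat.mod_eq_of_lt (by omega)]
      rcases Nat.lt_or_ge (j + 2) n with h | h
      · rw [Nat.mod_eq_of_lt (by omega)]
        omega
      · rw [show (j + 1).succ = n by omega, Nat.mod_self]
        omega
  have hp : ∀ i, p * s i = s (i + 1) * p := by
    intro i
    ext
    have h := Pelt_mul_Telt (q := q) (t := t) ((i + 1 : ℕ) : ZMod n)
    rw [← Nat.cast_succ] at h
    exact h
  have hp2 : p * p * s (n - 1 - 1) = s 0 * (p * p) := by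
    have hs : s (n - 1 - 1 + 1 + 1) = s 0 := by
      have h : ((n - 1 - 1 + 1 + 1 + 1 : ℕ) : ZMod n) = ((0 + 1 : ℕ) : ZMod n) := by
        rw [show n - 1 - 1 + 1 + 1 + 1 = n + 1 by omega]
        simp
      ext
      exact congrArg (Telt K n q t) h
    rw [mul_assoc, hp, ← mul_assoc, hp, hs, mul_assoc]
  have hX : ∀ i (h : i < n), X ⟨i, h⟩ = jmSeq s (p * (ascProd s (n - 1))⁻¹) i := by
    intro i
    induction i with
    | zero =>
      intro _
      rw [hX1, ofFn_prod_eq_inv_ascProd s (fun k : ℕ => Tinv (k : ZMod n)) (n - 1)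
        (fun _ => rfl)]
      rfl
    | succ i ih =>
      intro h
      rw [hXs (i + 1) (by omega) h]
      simp only [Nat.add_sub_cancel]
      rw [ih (by omega)]
      rfl
  rintro ⟨i, hi⟩ ⟨j, hj⟩
  rw [hX i hi, hX j hj, ← Units.val_mul, ← Units.val_mul,
    (commute_jmSeq_of_affine braid comm (fun i _ => hp i) hp2 (by omega) (by omega)).eq]
end
end

section
/- Let K be a field, n ≥ 2 an integer, and q, t ∈ Kˣ with q^m ≠ 1 and t^m ≠ 1 for all integers m ≥ 1. Let M be an H_{q,t}(GL_n)-module that is simple and Y-semisimple. Then for every z ∈ (Kˣ)^n the weight space M[z] has K-dimension at most 1. -/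
noncomputable section

/-- The weight space `M[z] = {v ∈ M : Y_i v = z_i v for i = 1,…,n}` of an
`H_{q,t}(GL_n)`-module `M`, for a weight `z ∈ (Kˣ)^n` (here the `Fin` index `a`
corresponds to the pair `(Y_{a+1}, z_{a+1})`). -/
def wtSet (K : Type*) [Field K] (n : ℕ) (q t : Kˣ) (M : Type*) [AddCommGroup M]
    [Module (DAHA K n q t) M] (z : Fin n → Kˣ) : Set M :=
  {v | ∀ i : Fin n, Yelt K n q t i • v = algebraMap K (DAHA K n q t) ((z i : K)) • v}

namespace AffinePerm

variable {n : ℕ}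

/-- `w` commutes with translation by `n`: `w` is an (extended) affine permutation. -/
def IsAffine (n : ℕ) (w : Equiv.Perm ℤ) : Prop :=
  ∀ i j : ℤ, (i : ZMod n) = (j : ZMod n) → w j - w i = j - i

/-- The translation `p ↦ p + k`. -/
def shift (k : ℤ) : Equiv.Perm ℤ := Equiv.addRight k

@[simp] lemma shift_apply (k p : ℤ) : shift k p = p + k := rfl

lemma shift_mul (k l : ℤ) : shift k * shift l = shift (k + l) := by
  ext p; simp [shift_apply]; ring

lemma shift_zero : shift 0 = 1 := by ext p; simp

lemma isAffine_shift (k : ℤ) : IsAffine n (shift k) := by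
  intro i j _; simp

lemma IsAffine.mul {v w : Equiv.Perm ℤ} (hv : IsAffine n v) (hw : IsAffine n w) :
    IsAffine n (v * w) := by
  intro i j h
  have h1 := hw i j h
  have h2 : ((w i : ℤ) : ZMod n) = ((w j : ℤ) : ZMod n) := by
    have h3 : w j = w i + (j - i) := by linarith
    rw [h3]; push_cast; rw [h]; ring
  have h3 := hv _ _ h2
  simp only [Equiv.Perm.mul_apply]
  linarith

lemma cast_succ_ne [Fact (1 < n)] (p : ℤ) : ((p + 1 : ℤ) : ZMod n) ≠ (p : ZMod n) := by
  push_cast; simp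

/-- The affine simple reflection exchanging `p` and `p + 1` for all `p` in the class `i`. -/
def refl (i : ZMod n) [Fact (1 < n)] : Equiv.Perm ℤ :=
  Function.Involutive.toPerm
    (fun p => if (p : ZMod n) = i then p + 1 else if (p : ZMod n) = i + 1 then p - 1 else p) <| by
    intro p
    by_cases h : (p : ZMod n) = i
    · simp [h]
    · by_cases h' : (p : ZMod n) = i + 1
      · simp [h']
      · simp [h, h']

variable [Fact (1 < n)]

lemma refl_def (i : ZMod n) (p : ℤ) : refl i p =
    if (p : ZMod n) = i then p + 1 else if (p : ZMod n) = i + 1 then p - 1 else p := rfl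

lemma refl_left {i : ZMod n} {p : ℤ} (h : (p : ZMod n) = i) : refl i p = p + 1 := by
  simp [refl_def, h]

lemma refl_right {i : ZMod n} {p : ℤ} (h : (p : ZMod n) = i) : refl i (p + 1) = p := by
  simp [refl_def, h]

lemma refl_of_ne {i : ZMod n} {p : ℤ} (h : (p : ZMod n) ≠ i) (h' : (p : ZMod n) ≠ i + 1) :
    refl i p = p := by
  simp [refl_def, h, h']

@[simp] lemma refl_mul_self (i : ZMod n) : refl i * refl i = 1 := by
  ext p
  exact (refl i).symm_apply_apply p

lemma mul_refl_refl (w : Equiv.Perm ℤ) (i : ZMod n) : w * refl i * refl i = w := by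
  rw [mul_assoc, refl_mul_self, mul_one]

lemma isAffine_refl (i : ZMod n) : IsAffine n (refl i) := by
  intro a b h
  simp only [refl_def, h]
  split_ifs <;> ring

lemma refl_mul_shift (i : ZMod n) (m : ℤ) :
    refl i * shift (-m) = shift (-m) * refl (i + (m : ZMod n)) := by
  ext p
  simp only [Equiv.Perm.mul_apply, shift_apply, refl_def]
  have h1 : ((p + -m : ℤ) : ZMod n) = i ↔ (p : ZMod n) = i + m := by
    push_cast; constructor <;> intro h <;> linear_combination h
  have h2 : ((p + -m : ℤ) : ZMod n) = i + 1 ↔ (p : ZMod n) = i + m + 1 := by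
    push_cast; constructor <;> intro h <;> linear_combination h
  simp only [h1, h2]
  split_ifs <;> ring

lemma refl_comm {i j : ZMod n} (hij : i ≠ j) (h1 : j ≠ i + 1) (h2 : i ≠ j + 1) :
    refl i * refl j = refl j * refl i := by
  ext p
  have h3 : i + 1 ≠ j + 1 := fun h => hij (add_right_cancel h)
  simp only [Equiv.Perm.mul_apply]
  by_cases a : (p : ZMod n) = i
  · have e1 : refl j p = p := refl_of_ne (by rwa [a]) (by rwa [a])
    have e2 : refl j (p + 1) = p + 1 := by
      refine refl_of_ne ?_ ?_ <;> push_cast <;> rw [a]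
      · exact h1.symm
      · exact h3
    rw [e1, refl_left a, e2]
  by_cases b : (p : ZMod n) = i + 1
  · obtain ⟨r, rfl⟩ : ∃ r, p = r + 1 := ⟨p - 1, by ring⟩
    have b' : (r : ZMod n) = i := by push_cast at b; exact add_right_cancel b
    have e1 : refl j r = r := refl_of_ne (by rwa [b']) (by rwa [b'])
    have e2 : refl j (r + 1) = r + 1 := by
      refine refl_of_ne ?_ ?_ <;> push_cast <;> rw [b']
      · exact h1.symm
      · exact h3
    rw [e2, refl_right b', e1]
  rw [refl_of_ne a b]
  refine refl_of_ne ?_ ?_ <;> rw [refl_def] <;> split_ifs with c d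
  · push_cast; rw [c]; exact h2.symm
  · push_cast; rw [d]; simpa using hij.symm
  · exact a
  · push_cast; rw [c]; exact h3.symm
  · push_cast; rw [d]; simpa using h1
  · exact b

lemma refl_braid (hn : 2 < n) (i : ZMod n) :
    refl i * refl (i + 1) * refl i = refl (i + 1) * refl i * refl (i + 1) := by
  have h2 : (2 : ZMod n) ≠ 0 := by
    intro h
    have := (ZMod.natCast_eq_zero_iff 2 n).1 (by exact_mod_cast h)
    exact absurd (Nat.le_of_dvd (by norm_num) this) (by omega)
  have triple : ∀ p : ℤ, (p : ZMod n) = i →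
      refl i p = p + 1 ∧ refl i (p + 1) = p ∧ refl i (p + 2) = p + 2 ∧
      refl (i + 1) p = p ∧ refl (i + 1) (p + 1) = p + 2 ∧ refl (i + 1) (p + 2) = p + 1 := by
    intro p hp
    have hp1 : ((p + 1 : ℤ) : ZMod n) = i + 1 := by push_cast; rw [hp]
    refine ⟨refl_left hp, refl_right hp, refl_of_ne ?_ ?_, refl_of_ne ?_ ?_, ?_, ?_⟩
    · push_cast; rw [hp]; simpa using h2
    · push_cast; rw [hp]
      intro h
      exact one_ne_zero (α := ZMod n) (by linear_combination h)
    · rw [hp]; simp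
    · rw [hp]
      intro h
      exact h2 (by linear_combination -h)
    · rw [refl_left hp1]; ring
    · rw [show p + 2 = p + 1 + 1 by ring, refl_right hp1]
  ext p
  simp only [Equiv.Perm.mul_apply]
  by_cases a : (p : ZMod n) = i
  · obtain ⟨e1, e2, e3, e4, e5, e6⟩ := triple p a
    simp [e1, e3, e4, e5]
  by_cases b : (p : ZMod n) = i + 1
  · obtain ⟨r, rfl⟩ : ∃ r, p = r + 1 := ⟨p - 1, by ring⟩
    obtain ⟨e1, e2, e3, e4, e5, e6⟩ := triple r (by push_cast at b; exact add_right_cancel b)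
    simp [e1, e2, e3, e4, e5, e6]
  by_cases c : (p : ZMod n) = i + 1 + 1
  · obtain ⟨r, rfl⟩ : ∃ r, p = r + 2 := ⟨p - 2, by ring⟩
    obtain ⟨e1, e2, e3, e4, e5, e6⟩ := triple r (by push_cast at c; linear_combination c)
    simp [e2, e3, e4, e6]
  simp [refl_of_ne a b, refl_of_ne b c]

lemma lt_refl_refl {i : ZMod n} {a b : ℤ} (hab : a < b) (h : ¬ refl i a < refl i b) :
    (a : ZMod n) = i ∧ b = a + 1 := by
  have hb : ∀ p : ℤ, p - 1 ≤ refl i p ∧ refl i p ≤ p + 1 := by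
    intro p; rw [refl_def]; split_ifs <;> constructor <;> omega
  have hne : refl i a ≠ refl i b := fun e => hab.ne ((refl i).injective e)
  by_cases ha : (a : ZMod n) = i
  · refine ⟨ha, ?_⟩
    rw [refl_left ha] at h hne
    by_contra hb1
    have := hb b
    have hb2 : b = a + 2 := by omega
    have hb3 : refl i b = a + 1 := by omega
    rw [← refl_left ha] at hb3
    exact hab.ne' ((refl i).injective hb3)
  · exfalso
    have h1 : refl i a ≤ a := by
      rw [refl_def, if_neg ha]; split_ifs <;> omega
    have := hb b
    have hb1 : b = a + 1 := by omega
    subst hb1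
    have h2 : refl i (a + 1) = a := by omega
    have h3 : refl i (refl i (a + 1)) = a + 1 := (refl i).symm_apply_apply (a + 1)
    rw [h2] at h3
    omega

/-- A potential function on affine permutations, decreasing along descents. -/
def energy (n : ℕ) [NeZero n] (w : Equiv.Perm ℤ) : ℕ :=
  (∑ c : ZMod n, (w c.val - c.val) ^ 2).toNat

lemma energy_mul_refl_lt [NeZero n] {w : Equiv.Perm ℤ} (hw : IsAffine n w) {i : ℤ}
    (hi : w (i + 1) < w i) : energy n (w * refl (i : ZMod n)) < energy n w := by
  have key : ∀ (v : Equiv.Perm ℤ), IsAffine n v → ∀ p : ℤ,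
      v (p : ZMod n).val - (p : ZMod n).val = v p - p := by
    intro v hv p
    have := hv p (p : ZMod n).val (by simp)
    linarith
  have hs := hw.mul (isAffine_refl (i : ZMod n))
  have hsum : ∑ c : ZMod n, (((w * refl (i : ZMod n)) c.val - c.val) ^ 2
      - (w c.val - c.val) ^ 2) = 2 * (w (i + 1) - w i) := by
    rw [Fintype.sum_eq_add (i : ZMod n) ((i + 1 : ℤ) : ZMod n) (cast_succ_ne i).symm]
    · rw [key _ hs, key _ hs, key _ hw, key _ hw]
      simp only [Equiv.Perm.mul_apply, refl_left, refl_right]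
      ring
    · rintro c ⟨h1, h2⟩
      have : refl (i : ZMod n) (c.val : ℤ) = c.val :=
        refl_of_ne (by simpa using h1) (by simpa using h2)
      rw [Equiv.Perm.mul_apply, this, sub_self]
  rw [Finset.sum_sub_distrib] at hsum
  have h0 : 0 ≤ ∑ c : ZMod n, ((w * refl (i : ZMod n)) c.val - c.val) ^ 2 :=
    Finset.sum_nonneg fun _ _ => sq_nonneg _
  unfold energy
  omega

lemma eq_shift_of_forall_lt {w : Equiv.Perm ℤ} (h : ∀ i, w i < w (i + 1)) :
    w = shift (w 0) := by
  have hm : StrictMono w := strictMono_int_of_lt_succ h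
  have hs : ∀ i, w (i + 1) = w i + 1 := by
    intro i
    obtain ⟨r, hr⟩ := w.surjective (w i + 1)
    have h1 : i < r := hm.lt_iff_lt.1 (by omega)
    have h2 : w (i + 1) ≤ w r := hm.le_iff_le.2 (by omega)
    have := h i
    omega
  ext p
  rw [shift_apply]
  induction p using Int.induction_on with
  | zero => simp
  | succ k ih => rw [hs, ih]; ring
  | pred k ih =>
    have := hs (-(k : ℤ) - 1)
    rw [sub_add_cancel] at this
    omega

lemma eq_one_of_fiber_mono {A : Type*} {z : ℤ → A} (hfin : ∀ c, {p | z p = c}.Finite)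
    {w : Equiv.Perm ℤ} (hz : ∀ p, z (w p) = z p)
    (hmono : ∀ a b, a < b → z a = z b → w a < w b) : w = 1 := by
  ext p
  simp only [Equiv.Perm.one_apply]
  have hit : ∀ k, z ((w ^ k) p) = z p := by
    intro k
    induction k with
    | zero => simp
    | succ k ih => rw [pow_succ', Equiv.Perm.mul_apply, hz, ih]
  have contra : ¬ Function.Injective fun k : ℕ => (w ^ k) p := fun hinj =>
    Set.infinite_of_injective_forall_mem hinj (fun k => hit k) (hfin (z p))
  by_contra hne
  apply contra
  rcases lt_or_gt_of_ne hne with h | h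
  · refine StrictAnti.injective (strictAnti_nat_of_succ_lt fun k => ?_)
    induction k with
    | zero => simpa using h
    | succ k ih =>
      have := hmono _ _ ih (by rw [hit, hit])
      rwa [pow_succ' w (k + 1), pow_succ' w k] at *
  · refine StrictMono.injective (strictMono_nat_of_lt_succ fun k => ?_)
    induction k with
    | zero => simpa using h
    | succ k ih =>
      have := hmono _ _ ih (by rw [hit, hit])
      rwa [pow_succ' w (k + 1), pow_succ' w k] at *

end AffinePerm

/-- Operators on a vector space satisfying the relations of the double affine Hecke algebra in
periodic form: `T i` exchanges the positions `p, p + 1` with `p` in the class `i`, the `X p` are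
quasi-periodic in `p : ℤ`, and `h` stands for `t - t⁻¹`. -/
structure DahaAction (K M : Type*) [Field K] [AddCommGroup M] [Module K M] (n : ℕ) (h : K) where
  T : ZMod n → Module.End K M
  X : ℤ → Module.End K M
  P : (Module.End K M)ˣ
  quad : ∀ i u, T i (T i u) = h • T i u + u
  braid : ∀ i u, T i (T (i + 1) (T i u)) = T (i + 1) (T i (T (i + 1) u))
  comm : ∀ i j u, j ≠ i + 1 → i ≠ j + 1 → T i (T j u) = T j (T i u)
  X_comm : ∀ p r, Commute (X p) (X r)
  T_X_T : ∀ (p : ℤ) u, T (p : ZMod n) (X p (T (p : ZMod n) u)) = X (p + 1) u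
  T_X_comm : ∀ (i : ZMod n) (p : ℤ) u, (p : ZMod n) ≠ i → (p : ZMod n) ≠ i + 1 →
    T i (X p u) = X p (T i u)
  P_T : ∀ i : ZMod n, (P : Module.End K M) * T i = T (i + 1) * P
  P_X : ∀ p : ℤ, (P : Module.End K M) * X p = X (p + 1) * P

namespace DahaAction

open AffinePerm

variable {K M : Type*} [Field K] [AddCommGroup M] [Module K M] {n : ℕ} {h : K}
  (D : DahaAction K M n h)

/-- `u` is a simultaneous eigenvector of the operators `X p`, of weight `y`. -/
def IsWeight (y : ℤ → K) (u : M) : Prop := ∀ p, D.X p u = y p • u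

lemma zpow_mul_of_mul (P : (Module.End K M)ˣ) (A : ℤ → Module.End K M)
    (hA : ∀ p, (P : Module.End K M) * A p = A (p + 1) * P) (m p : ℤ) :
    ((P ^ m : (Module.End K M)ˣ) : Module.End K M) * A p =
      A (p + m) * (P ^ m : (Module.End K M)ˣ) := by
  induction m using Int.induction_on generalizing p with
  | zero => simp
  | succ k ih =>
    rw [zpow_add_one, Units.val_mul, mul_assoc, hA, ← mul_assoc, ih, mul_assoc]
    congr 2; ring
  | pred k ih =>
    have hinv : ((P⁻¹ : (Module.End K M)ˣ) : Module.End K M) * A p =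
        A (p - 1) * (P⁻¹ : (Module.End K M)ˣ) := by
      rw [Units.inv_mul_eq_iff_eq_mul, ← mul_assoc, hA, Units.mul_inv_cancel_right, sub_add_cancel]
    rw [zpow_sub_one, Units.val_mul, mul_assoc, hinv, ← mul_assoc, ih, mul_assoc]
    congr 2; ring

lemma zpow_T (m : ℤ) (i : ZMod n) (u : M) :
    ((D.P ^ m : (Module.End K M)ˣ) : Module.End K M) (D.T i u) =
      D.T (i + (m : ZMod n)) (((D.P ^ m : (Module.End K M)ˣ) : Module.End K M) u) := by
  obtain ⟨i, rfl⟩ := ZMod.intCast_surjective i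
  have := zpow_mul_of_mul D.P (fun p : ℤ => D.T (p : ZMod n))
    (fun p => by push_cast; exact D.P_T _) m i
  push_cast at this
  exact LinearMap.congr_fun this u

lemma zpow_X (m p : ℤ) (u : M) :
    ((D.P ^ m : (Module.End K M)ˣ) : Module.End K M) (D.X p u) =
      D.X (p + m) (((D.P ^ m : (Module.End K M)ˣ) : Module.End K M) u) :=
  LinearMap.congr_fun (zpow_mul_of_mul D.P D.X D.P_X m p) u

variable {D} in
lemma IsWeight.zpow {y : ℤ → K} {u : M} (hu : D.IsWeight y u) (m : ℤ) :
    D.IsWeight (y ∘ shift (-m)) (((D.P ^ m : (Module.End K M)ˣ) : Module.End K M) u) := by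
  intro p
  have := D.zpow_X m (p + -m) u
  rw [neg_add_cancel_right, hu, map_smul] at this
  exact this.symm

lemma X_succ_T (p : ℤ) (u : M) :
    D.X (p + 1) (D.T (p : ZMod n) u) = D.T (p : ZMod n) (D.X p u) + h • D.X (p + 1) u := by
  rw [← D.T_X_T p (D.T _ u), D.quad, map_add, map_add, map_smul, map_smul, D.T_X_T, add_comm]

lemma X_T (p : ℤ) (u : M) :
    D.X p (D.T (p : ZMod n) u) = D.T (p : ZMod n) (D.X (p + 1) u) - h • D.X (p + 1) u := by
  rw [← D.T_X_T p u, D.quad]; abel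

/-- The intertwining operator, on vectors whose weight `y` satisfies `y p / y (p + 1) = r`. -/
def inter (r : K) (i : ZMod n) : Module.End K M := (r - 1) • D.T i + h • 1

lemma inter_apply (r : K) (i : ZMod n) (u : M) :
    D.inter r i u = (r - 1) • D.T i u + h • u := rfl

lemma mem_cases (i : ZMod n) (p : ℤ) :
    (p : ZMod n) = i ∨ (∃ r : ℤ, (r : ZMod n) = i ∧ p = r + 1) ∨
      ((p : ZMod n) ≠ i ∧ (p : ZMod n) ≠ i + 1) := by
  by_cases a : (p : ZMod n) = i
  · exact .inl a
  by_cases b : (p : ZMod n) = i + 1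
  · exact .inr (.inl ⟨p - 1, by push_cast; rw [b]; ring, by ring⟩)
  · exact .inr (.inr ⟨a, b⟩)

variable {D} in
lemma IsWeight.inter [Fact (1 < n)] {y : ℤ → K} {u : M} (hu : D.IsWeight y u)
    (hy : ∀ p, y p ≠ 0) {i : ZMod n} {r : K} (hr : ∀ p : ℤ, (p : ZMod n) = i → r = y p / y (p + 1)) :
    D.IsWeight (y ∘ refl i) (D.inter r i u) := by
  intro p
  rw [inter_apply, map_add, map_smul, map_smul]
  rcases mem_cases i p with a | ⟨p, a, rfl⟩ | ⟨a, b⟩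
  · have e : r * y (p + 1) = y p := by rw [hr p a, div_mul_cancel₀ _ (hy _)]
    rw [Function.comp_apply, refl_left a]
    subst a
    rw [D.X_T, hu, hu, map_smul, ← e]
    module
  · have e : r * y (p + 1) = y p := by rw [hr p a, div_mul_cancel₀ _ (hy _)]
    rw [Function.comp_apply, refl_right a]
    subst a
    rw [D.X_succ_T, hu, hu, map_smul, ← e]
    module
  · rw [Function.comp_apply, refl_of_ne a b, ← D.T_X_comm i p u a b, hu, map_smul]
    module

lemma inter_inter {r s : K} (i : ZMod n) (u : M) (hrs : r * s = 1) :
    D.inter s i (D.inter r i u) = ((s - 1) * (r - 1) + h * h) • u := by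
  simp only [inter_apply, map_add, map_smul, D.quad, smul_add, smul_smul]
  have e : (s - 1) * (r - 1) * h + (s - 1) * h + h * (r - 1) = 0 := by linear_combination h * hrs
  have : ((s - 1) * (r - 1)) • u + ((s - 1) * (r - 1) * h + (s - 1) * h + h * (r - 1)) • D.T i u
     + (h * h) • u = ((s - 1) * (r - 1) + h * h) • u := by rw [e]; module
  rw [← this]; module

lemma inter_comm {r s : K} {i j : ZMod n} (h1 : j ≠ i + 1) (h2 : i ≠ j + 1) (u : M) :
    D.inter s j (D.inter r i u) = D.inter r i (D.inter s j u) := by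
  simp only [inter_apply, map_add, map_smul, D.comm i j u h1 h2]
  module

lemma inter_braid (r s : K) (i : ZMod n) (u : M) :
    D.inter s i (D.inter (r * s) (i + 1) (D.inter r i u)) =
      D.inter r (i + 1) (D.inter (r * s) i (D.inter s (i + 1) u)) := by
  simp only [inter_apply, map_add, map_smul, D.braid, D.quad, smul_add]
  module

variable {D} in
/-- On a module spanned by eigenvectors, weights have distinct adjacent entries. -/
lemma IsWeight.eq_zero {y : ℤ → K} {u : M} (hu : D.IsWeight y u) (hh : h ≠ 0)
    (hss : ∀ p, ⨆ μ, (D.X p).eigenspace μ = ⊤) {p : ℤ} (hy : y (p + 1) ≠ 0)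
    (he : y p = y (p + 1)) : u = 0 := by
  set μ := y (p + 1) with hμ
  set f := D.X (p + 1) with hf
  set x := D.T (p : ZMod n) u with hx
  have h1 : f x - μ • x = (h * μ) • u := by
    rw [hf, hx, D.X_succ_T, hu, hu, map_smul, he]; module
  have h2 : (f x - μ • x) ∈ f.eigenspace μ := by
    rw [h1]
    exact Submodule.smul_mem _ _ (Module.End.mem_eigenspace_iff.2 (hu (p + 1)))
  have h3 : ∀ x : M, (f x - μ • x) ∈ ⨆ ν, ⨆ (_ : ν ≠ μ), f.eigenspace ν := by
    intro x
    have hx : x ∈ ⨆ μ, f.eigenspace μ := by rw [hf, hss]; trivial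
    induction hx using Submodule.iSup_induction' with
    | mem ν x hx =>
      rw [Module.End.mem_eigenspace_iff] at hx
      rw [hx, ← sub_smul]
      by_cases hν : ν = μ
      · simp [hν]
      · exact Submodule.smul_mem _ _ (Submodule.mem_iSup_of_mem ν
          (Submodule.mem_iSup_of_mem hν (Module.End.mem_eigenspace_iff.2 hx)))
    | zero => simp
    | add x y _ _ hx hy =>
      have := Submodule.add_mem _ hx hy
      convert this using 1
      rw [map_add]; module
  have h4 := (Submodule.disjoint_def.1 (f.eigenspaces_iSupIndep μ)) _ h2 (h3 x)
  rw [h1] at h4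
  exact (smul_eq_zero.1 h4).resolve_left (mul_ne_zero hh hy)

/-- A nowhere vanishing function `z` on `ℤ` with `z (p + n) = c * z p`. -/
structure QuasiPeriodic (n : ℕ) (c : K) (z : ℤ → K) : Prop where
  ne_zero : ∀ p, z p ≠ 0
  add_mul : ∀ p k : ℤ, z (p + k * n) = c ^ k * z p

lemma exists_add_mul {i j : ℤ} (hij : (i : ZMod n) = (j : ZMod n)) : ∃ k : ℤ, j = i + k * n := by
  obtain ⟨k, hk⟩ := (ZMod.intCast_eq_intCast_iff_dvd_sub i j n).1 hij
  exact ⟨k, by linarith⟩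

/-- The ratio of the adjacent entries at `i` of the weight `z ∘ w`. -/
def ratio (z : ℤ → K) (w : Equiv.Perm ℤ) (i : ℤ) : K := z (w i) / z (w (i + 1))

lemma ratio_congr {c : K} {z : ℤ → K} (hz : QuasiPeriodic n c z) (hc : c ≠ 0)
    {w : Equiv.Perm ℤ} (hw : IsAffine n w) {i j : ℤ} (hij : (i : ZMod n) = (j : ZMod n)) :
    ratio z w i = ratio z w j := by
  have h1 := hw i j hij
  have h2 := hw (i + 1) (j + 1) (by push_cast; rw [hij])
  obtain ⟨k, rfl⟩ := exists_add_mul hij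
  have e1 : w (i + k * n) = w i + k * n := by linarith
  have e2 : w (i + k * n + 1) = w (i + 1) + k * n := by linarith
  rw [ratio, ratio, e1, e2, hz.add_mul, hz.add_mul,
    mul_div_mul_left _ _ (zpow_ne_zero k hc)]

lemma QuasiPeriodic.finite_fiber [NeZero n] {c : K} {z : ℤ → K} (hz : QuasiPeriodic n c z)
    (hq : ∀ k : ℤ, c ^ k = 1 → k = 0) (x : K) : {p | z p = x}.Finite := by
  refine Set.Finite.of_finite_image (f := fun p : ℤ => (p : ZMod n)) (Set.toFinite _) ?_
  intro a ha b hb hab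
  obtain ⟨k, rfl⟩ := exists_add_mul hab
  simp only [Set.mem_ofPred_eq] at ha hb
  rw [hz.add_mul, ha] at hb
  have hx : x ≠ 0 := ha ▸ hz.ne_zero a
  have := hq k (mul_right_cancel₀ hx (hb.trans (one_mul x).symm))
  simp [this]

variable [Fact (1 < n)]

/-- `D.Reach z v w u` says that `u` is obtained from the vector `v` of weight `z` by a power of `P`
and intertwiners along a path of ascents ending at the affine permutation `w`; then `u` has
weight `z ∘ w`. -/
inductive Reach (z : ℤ → K) (v : M) : Equiv.Perm ℤ → M → Prop
  | base (k : ℤ) : Reach z v (shift k) (((D.P ^ (-k) : (Module.End K M)ˣ) : Module.End K M) v)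
  | step (w : Equiv.Perm ℤ) (i : ℤ) (u : M) : Reach z v w u → w i < w (i + 1) →
      Reach z v (w * refl (i : ZMod n)) (D.inter (ratio z w i) (i : ZMod n) u)

section Reach

variable {D} {c : K} {z : ℤ → K} {v : M}

lemma Reach.isAffine {w : Equiv.Perm ℤ} {u : M} (hr : D.Reach z v w u) : IsAffine n w := by
  induction hr with
  | base k => exact isAffine_shift k
  | step w i u _ _ ih => exact ih.mul (isAffine_refl _)

lemma Reach.isWeight (hz : QuasiPeriodic n c z) (hc : c ≠ 0) (hv : D.IsWeight z v)
    {w : Equiv.Perm ℤ} {u : M} (hr : D.Reach z v w u) : D.IsWeight (z ∘ w) u := by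
  induction hr with
  | base k => simpa using hv.zpow (-k)
  | step w i u hr _ ih =>
    exact ih.inter (fun p => hz.ne_zero _)
      (fun p hp => ratio_congr hz hc hr.isAffine hp.symm)

lemma Reach.zpow {w : Equiv.Perm ℤ} {u : M}
    (hr : D.Reach z v w u) (m : ℤ) :
    D.Reach z v (w * shift (-m)) (((D.P ^ m : (Module.End K M)ˣ) : Module.End K M) u) := by
  induction hr with
  | base k =>
    rw [shift_mul, ← Module.End.mul_apply, ← Units.val_mul, ← zpow_add,
      show m + -k = -(k + -m) by ring]
    exact .base _
  | step w i u hr hi ih =>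
    have key := Reach.step _ (i + m) _ ih (by
      simp only [Equiv.Perm.mul_apply, shift_apply]
      rwa [add_neg_cancel_right, show i + m + 1 + -m = i + 1 by ring])
    have e : ratio z (w * shift (-m)) (i + m) = ratio z w i := by
      simp only [ratio, Equiv.Perm.mul_apply, shift_apply]
      rw [add_neg_cancel_right, show i + m + 1 + -m = i + 1 by ring]
    rw [mul_assoc, refl_mul_shift, ← mul_assoc, inter_apply, map_add, map_smul, map_smul, zpow_T]
    rw [e, inter_apply] at key
    push_cast at key
    exact key

lemma Reach.exists_of_isAffine [NeZero n] {w : Equiv.Perm ℤ} (hw : IsAffine n w) :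
    ∃ u, D.Reach z v w u := by
  induction hN : energy n w using Nat.strong_induction_on generalizing w with
  | _ N ih =>
    subst hN
    by_cases hd : ∀ i, w i < w (i + 1)
    · rw [eq_shift_of_forall_lt hd]
      exact ⟨_, .base _⟩
    · push Not at hd
      obtain ⟨i, hi⟩ := hd
      have hi' : w (i + 1) < w i := lt_of_le_of_ne hi fun e => by simpa using w.injective e
      obtain ⟨u, hu⟩ := ih _ (energy_mul_refl_lt hw hi') (hw.mul (isAffine_refl _)) rfl
      have := Reach.step _ i u hu (by
        simpa [Equiv.Perm.mul_apply, refl_left, refl_right] using hi')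
      rw [mul_refl_refl] at this
      exact ⟨_, this⟩

lemma Reach.cases_eq {w : Equiv.Perm ℤ} {u : M} (hr : D.Reach z v w u) :
    (∃ k, w = shift k ∧ u = ((D.P ^ (-k) : (Module.End K M)ˣ) : Module.End K M) v) ∨
    ∃ (i : ℤ) (u₁ : M), w (i + 1) < w i ∧ D.Reach z v (w * refl (i : ZMod n)) u₁ ∧
      u = D.inter (ratio z (w * refl (i : ZMod n)) i) (i : ZMod n) u₁ := by
  cases hr with
  | base k => exact .inl ⟨k, rfl, rfl⟩
  | step w i u hr hi =>
    refine .inr ⟨i, u, ?_, ?_, ?_⟩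
    · simpa [Equiv.Perm.mul_apply, refl_left, refl_right] using hi
    · rwa [mul_refl_refl]
    · rw [mul_refl_refl]

/-- The local confluence at two adjacent descents. -/
lemma Reach.braid_eq [NeZero n] {w : Equiv.Perm ℤ} (hw : IsAffine n w)
    (ih : ∀ w', energy n w' < energy n w → ∀ a b, D.Reach z v w' a → D.Reach z v w' b → a = b)
    (hz : QuasiPeriodic n c z) {i : ℤ} {u₁ u₂ : M} (hi : w (i + 1) < w i)
    (hj : w (i + 2) < w (i + 1))
    (h1 : D.Reach z v (w * refl (i : ZMod n)) u₁)
    (h2 : D.Reach z v (w * refl (i + 1 : ZMod n)) u₂) :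
    D.inter (ratio z (w * refl (i : ZMod n)) i) (i : ZMod n) u₁ =
      D.inter (ratio z (w * refl (i + 1 : ZMod n)) (i + 1)) (i + 1 : ZMod n) u₂ := by
  have hn1 : 1 < n := Fact.out
  have hn : 2 < n := by
    by_contra hn
    obtain rfl : n = 2 := by omega
    have := hw i (i + 2) (by
      push_cast
      rw [show (2 : ZMod 2) = 0 from rfl, add_zero])
    omega
  have two_ne : (2 : ZMod n) ≠ 0 := by
    intro h
    have := (ZMod.natCast_eq_zero_iff 2 n).1 (by exact_mod_cast h)
    exact absurd (Nat.le_of_dvd (by norm_num) this) (by omega)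
  set s := refl (i : ZMod n) with hs
  set r := refl (i + 1 : ZMod n) with hr
  have s0 : s i = i + 1 := refl_left rfl
  have s1 : s (i + 1) = i := refl_right rfl
  have s2 : s (i + 2) = i + 2 := by
    refine refl_of_ne ?_ ?_ <;> push_cast
    · simpa using two_ne
    · intro h; exact one_ne_zero (α := ZMod n) (by linear_combination h)
  have hi1 : ((i + 1 : ℤ) : ZMod n) = i + 1 := by push_cast; rfl
  have r0 : r i = i := by
    refine refl_of_ne (by simp) ?_
    intro h; exact two_ne (by linear_combination -h)
  have r1 : r (i + 1) = i + 2 := by rw [hr, refl_left hi1]; ring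
  have r2 : r (i + 2) = i + 1 := by rw [hr, show i + 2 = i + 1 + 1 by ring, refl_right hi1]
  have hsr : s * r * s = r * s * r := refl_braid hn _
  obtain ⟨u₃, h3⟩ := Reach.exists_of_isAffine (D := D) (z := z) (v := v)
    ((((hw.mul (isAffine_refl (i : ZMod n))).mul (isAffine_refl (i + 1 : ZMod n))).mul
      (isAffine_refl (i : ZMod n))))
  rw [← hs, ← hr] at h3
  have e3 : w * s * r * s = w * r * s * r := by
    rw [mul_assoc, mul_assoc, ← mul_assoc s, hsr]; simp only [mul_assoc]
  have hii : i + 1 + 1 = i + 2 := by ring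
  -- the path through `w * s`
  have p1 := Reach.step _ i _ h3 (by simp only [Equiv.Perm.mul_apply, s0, s1, s2, r0, r1]; omega)
  rw [← hs, mul_assoc _ s s, refl_mul_self, mul_one] at p1
  have p2 := Reach.step _ (i + 1) _ p1
    (by simp only [Equiv.Perm.mul_apply, hii, s1, s2, r1, r2]; omega)
  rw [hi1, ← hr, mul_assoc _ r r, refl_mul_self, mul_one] at p2
  have q2 := ih _ (energy_mul_refl_lt hw hi) _ _ h1 p2
  -- the path through `w * r`
  have h3' := h3
  rw [e3] at h3'
  have p3 := Reach.step _ (i + 1) _ h3'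
    (by simp only [Equiv.Perm.mul_apply, hii, s1, s2, r0, r1, r2]; omega)
  rw [hi1, ← hr, mul_assoc _ r r, refl_mul_self, mul_one] at p3
  have p4 := Reach.step _ i _ p3 (by simp only [Equiv.Perm.mul_apply, s0, s1, r0, r1]; omega)
  rw [← hs, mul_assoc _ s s, refl_mul_self, mul_one] at p4
  have q4 := ih _ (by
    have := energy_mul_refl_lt hw (i := i + 1) (by rwa [hii])
    rwa [hi1] at this) _ _ h2 p4
  have hne := hz.ne_zero
  rw [q2, q4]
  simp only [ratio, Equiv.Perm.mul_apply, hii, s0, s1, s2, r0, r1, r2]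
  have := D.inter_braid (z (w (i + 2)) / z (w (i + 1))) (z (w (i + 1)) / z (w i)) (i : ZMod n) u₃
  rwa [div_mul_div_cancel₀ (hne _)] at this

lemma Reach.unique [NeZero n] (hz : QuasiPeriodic n c z) (hc : c ≠ 0) {w : Equiv.Perm ℤ} {a b : M}
    (ha : D.Reach z v w a) (hb : D.Reach z v w b) : a = b := by
  induction hN : energy n w using Nat.strong_induction_on generalizing w a b with
  | _ N ih =>
    subst hN
    have ih' : ∀ w', energy n w' < energy n w →
        ∀ a b, D.Reach z v w' a → D.Reach z v w' b → a = b :=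
      fun w' hw' a b ha hb => ih _ hw' ha hb rfl
    have hw := ha.isAffine
    rcases ha.cases_eq with ⟨k, rfl, rfl⟩ | ⟨i, u₁, hi, h1, rfl⟩
    · rcases hb.cases_eq with ⟨l, hl, rfl⟩ | ⟨j, u₂, hj, h2, rfl⟩
      · have : k = l := by simpa using DFunLike.congr_fun hl 0
        rw [this]
      · simp at hj
    rcases hb.cases_eq with ⟨l, rfl, rfl⟩ | ⟨j, u₂, hj, h2, rfl⟩
    · simp at hi
    have hlt : ∀ {i j : ℤ}, (i : ZMod n) = (j : ZMod n) → w (i + 1) < w i → w (j + 1) < w j := by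
      intro i j hij hi
      have e1 := hw i j hij
      have e2 := hw (i + 1) (j + 1) (by push_cast; rw [hij])
      linarith
    by_cases c1 : (i : ZMod n) = j
    · rw [ratio_congr hz hc h1.isAffine c1]
      rw [c1] at h1 ⊢
      rw [ih' _ (energy_mul_refl_lt hw hj) _ _ h1 h2]
    by_cases c2 : (j : ZMod n) = i + 1
    · have c2' : (j : ZMod n) = ((i + 1 : ℤ) : ZMod n) := by push_cast; exact c2
      rw [ratio_congr hz hc h2.isAffine c2']
      rw [c2] at h2 ⊢
      have := hlt c2' hj
      rw [show i + 1 + 1 = i + 2 by ring] at this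
      exact Reach.braid_eq hw ih' hz hi this h1 h2
    by_cases c3 : (i : ZMod n) = j + 1
    · have c3' : (i : ZMod n) = ((j + 1 : ℤ) : ZMod n) := by push_cast; exact c3
      rw [ratio_congr hz hc h1.isAffine c3']
      rw [c3] at h1 ⊢
      have := hlt c3' hi
      rw [show j + 1 + 1 = j + 2 by ring] at this
      exact (Reach.braid_eq hw ih' hz hj this h2 h1).symm
    obtain ⟨u₃, h3⟩ := Reach.exists_of_isAffine (D := D) (z := z) (v := v)
      ((hw.mul (isAffine_refl (i : ZMod n))).mul (isAffine_refl (j : ZMod n)))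
    have hcomm := refl_comm c1 c2 c3
    have c4 : (i + 1 : ZMod n) ≠ j + 1 := fun h => c1 (add_right_cancel h)
    have ei : refl (j : ZMod n) i = i := refl_of_ne c1 c3
    have ei' : refl (j : ZMod n) (i + 1) = i + 1 := by
      refine refl_of_ne ?_ ?_ <;> push_cast
      · exact Ne.symm c2
      · exact c4
    have ej : refl (i : ZMod n) j = j := refl_of_ne (Ne.symm c1) c2
    have ej' : refl (i : ZMod n) (j + 1) = j + 1 := by
      refine refl_of_ne ?_ ?_ <;> push_cast
      · exact Ne.symm c3
      · exact c4.symm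
    have p1 := Reach.step _ j _ h3 (by
      simpa only [Equiv.Perm.mul_apply, refl_left, refl_right, ej, ej'] using hj)
    rw [mul_refl_refl] at p1
    have h3' := h3
    rw [mul_assoc, hcomm, ← mul_assoc] at h3'
    have p2 := Reach.step _ i _ h3' (by
      simpa only [Equiv.Perm.mul_apply, refl_left, refl_right, ei, ei'] using hi)
    rw [mul_refl_refl] at p2
    rw [ih' _ (energy_mul_refl_lt hw hi) _ _ h1 p1, ih' _ (energy_mul_refl_lt hw hj) _ _ h2 p2,
      D.inter_comm c3 c2]
    simp only [ratio, Equiv.Perm.mul_apply, refl_left, refl_right, ei, ei', ej, ej']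

lemma Reach.lt_of_eq (hz : QuasiPeriodic n c z) (hc : c ≠ 0) (hv : D.IsWeight z v) (hh : h ≠ 0)
    (hss : ∀ p, ⨆ μ, (D.X p).eigenspace μ = ⊤) {w : Equiv.Perm ℤ} {u : M}
    (hr : D.Reach z v w u) (hu : u ≠ 0) {a b : ℤ} (hab : a < b) (he : z (w a) = z (w b)) :
    w a < w b := by
  induction hr generalizing a b with
  | base k => simpa using hab
  | step w i u hr hi ih =>
    have hu' : u ≠ 0 := by rintro rfl; exact hu (map_zero _)
    by_cases hs : refl (i : ZMod n) a < refl (i : ZMod n) b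
    · exact ih hu' hs he
    · obtain ⟨h1, rfl⟩ := lt_refl_refl hab hs
      rw [Equiv.Perm.mul_apply, Equiv.Perm.mul_apply, refl_left h1, refl_right h1] at he
      exact absurd ((hr.isWeight hz hc hv).eq_zero hh hss (hz.ne_zero _) he.symm) hu'

lemma Reach.eq_of_weight_eq [NeZero n] (hz : QuasiPeriodic n c z) (hc : c ≠ 0)
    (hq : ∀ k : ℤ, c ^ k = 1 → k = 0) (hv : D.IsWeight z v) (hh : h ≠ 0)
    (hss : ∀ p, ⨆ μ, (D.X p).eigenspace μ = ⊤) {w : Equiv.Perm ℤ} {u : M}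
    (hr : D.Reach z v w u) (hu : u ≠ 0) (he : z ∘ w = z) : u = v := by
  have hp : ∀ p, z (w p) = z p := fun p => congr_fun he p
  have hw : w = 1 := eq_one_of_fiber_mono (hz.finite_fiber hq) hp fun a b hab hzab =>
    hr.lt_of_eq hz hc hv hh hss hu hab (by rw [hp, hp, hzab])
  have h1 : D.Reach z v 1 v := by simpa [shift_zero] using Reach.base (D := D) (z := z) (v := v) 0
  exact hr.unique hz hc (hw ▸ h1)

lemma Reach.T_mem [NeZero n] (hz : QuasiPeriodic n c z) (hc : c ≠ 0) (hv : D.IsWeight z v)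
    (hh : h ≠ 0) (hss : ∀ p, ⨆ μ, (D.X p).eigenspace μ = ⊤) {w : Equiv.Perm ℤ} {u : M}
    (hr : D.Reach z v w u) (i : ZMod n) :
    D.T i u ∈ Submodule.span K {x | ∃ w, D.Reach z v w x} := by
  obtain ⟨i, rfl⟩ := ZMod.intCast_surjective i
  have hwt := hr.isWeight hz hc hv
  by_cases hρ : ratio z w i = 1
  · rw [hwt.eq_zero hh hss (hz.ne_zero _) ((div_eq_one_iff_eq (hz.ne_zero _)).1 hρ), map_zero]
    exact Submodule.zero_mem _
  have hmem : D.inter (ratio z w i) (i : ZMod n) u ∈ Submodule.span K {x | ∃ w, D.Reach z v w x} := by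
    rcases lt_trichotomy (w i) (w (i + 1)) with hi | hi | hi
    · exact Submodule.subset_span ⟨_, .step _ _ _ hr hi⟩
    · simpa using w.injective hi
    · obtain ⟨u₁, h1⟩ := Reach.exists_of_isAffine (D := D) (z := z) (v := v)
        (hr.isAffine.mul (isAffine_refl (i : ZMod n)))
      have h2 := Reach.step _ i _ h1 (by
        simpa only [Equiv.Perm.mul_apply, refl_left, refl_right] using hi)
      rw [mul_refl_refl] at h2
      rw [hr.unique hz hc h2, inter_inter]
      · exact Submodule.smul_mem _ _ (Submodule.subset_span ⟨_, h1⟩)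
      · simp only [ratio, Equiv.Perm.mul_apply, refl_left, refl_right]
        have := hz.ne_zero
        field_simp [this (w i), this (w (i + 1))]
  have hne : ratio z w i - 1 ≠ 0 := sub_ne_zero.2 hρ
  have : D.T (i : ZMod n) u =
      (ratio z w i - 1)⁻¹ • (D.inter (ratio z w i) (i : ZMod n) u - h • u) := by
    rw [inter_apply, add_sub_cancel_right, inv_smul_smul₀ hne]
  rw [this]
  exact Submodule.smul_mem _ _ (Submodule.sub_mem _ hmem
    (Submodule.smul_mem _ _ (Submodule.subset_span ⟨_, hr⟩)))

end Reach

/-- If every nonzero subspace that is spanned by weight vectors and stable under the `T i`, `P`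
and `P⁻¹` is everything, then weight spaces are at most one-dimensional. -/
theorem mem_span_of_isWeight [NeZero n] {c : K} {z : ℤ → K} {v x : M} (hh : h ≠ 0)
    (hz : QuasiPeriodic n c z) (hc : c ≠ 0) (hq : ∀ k : ℤ, c ^ k = 1 → k = 0)
    (hss : ∀ p, ⨆ μ, (D.X p).eigenspace μ = ⊤)
    (hsimple : ∀ s : Set M, (∀ u ∈ s, ∃ y : ℤ → K, (∀ p, y p ≠ 0) ∧ D.IsWeight y u) →
      (∀ u ∈ s, ∀ i, D.T i u ∈ Submodule.span K s) →
      (∀ u ∈ s, ∀ m : ℤ, ((D.P ^ m : (Module.End K M)ˣ) : Module.End K M) u ∈ s) →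
      (∃ u ∈ s, u ≠ 0) → Submodule.span K s = ⊤)
    (hv : D.IsWeight z v) (hv0 : v ≠ 0) (hx : D.IsWeight z x) :
    x ∈ Submodule.span K {v} := by
  have htop := hsimple {x | ∃ w, D.Reach z v w x}
    (fun u ⟨w, hr⟩ => ⟨z ∘ w, fun p => hz.ne_zero _, hr.isWeight hz hc hv⟩)
    (fun u ⟨w, hr⟩ i => hr.T_mem hz hc hv hh hss i)
    (fun u ⟨w, hr⟩ m => ⟨_, hr.zpow m⟩)
    ⟨v, ⟨1, by simpa [shift_zero] using Reach.base (D := D) (z := z) (v := v) 0⟩, hv0⟩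
  let W : (ℤ → K) → Submodule K M := fun y => ⨅ p, (D.X p).maxGenEigenspace (y p)
  have hW : ∀ {y u}, D.IsWeight y u → u ∈ W y := fun {y u} hu => by
    refine Submodule.mem_iInf _ |>.2 fun p => ?_
    exact (Module.End.genEigenspace _ _).monotone le_top
      (Module.End.mem_eigenspace_iff.2 (hu p))
  have hind : iSupIndep W := Module.End.independent_iInf_maxGenEigenspace_of_forall_mapsTo D.X
    fun p r μ => Module.End.mapsTo_maxGenEigenspace_of_comm (D.X_comm r p) μ
  have hle : Submodule.span K {x | ∃ w, D.Reach z v w x} ≤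
      Submodule.span K {v} ⊔ ⨆ y, ⨆ (_ : y ≠ z), W y := by
    refine Submodule.span_le.2 ?_
    rintro u ⟨w, hr⟩
    by_cases hu : u = 0
    · rw [hu]; exact Submodule.zero_mem _
    by_cases he : z ∘ w = z
    · rw [hr.eq_of_weight_eq hz hc hq hv hh hss hu he]
      exact Submodule.mem_sup_left (Submodule.mem_span_singleton_self v)
    · exact Submodule.mem_sup_right (Submodule.mem_iSup_of_mem _
        (Submodule.mem_iSup_of_mem he (hW (hr.isWeight hz hc hv))))
  rw [htop] at hle
  obtain ⟨a, ha, b, hb, rfl⟩ := Submodule.mem_sup.1 (hle (Submodule.mem_top (x := x)))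
  obtain ⟨k, rfl⟩ := Submodule.mem_span_singleton.1 ha
  have hbW : b ∈ W z := by
    have := Submodule.sub_mem _ (hW hx) (Submodule.smul_mem _ k (hW hv))
    rwa [add_sub_cancel_left] at this
  rw [Submodule.disjoint_def.1 (hind z) b hbW hb, add_zero]
  exact ha

end DahaAction

namespace DAHA

open AffinePerm

section Index

variable {n : ℕ} [NeZero n]

/-- The position in `Fin n` of an integer modulo `n`. -/
def idx (p : ℤ) : Fin n :=
  ⟨(p % n).toNat, by
    have hn : (0 : ℤ) < n := by exact_mod_cast Nat.pos_of_ne_zero (NeZero.ne n)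
    have := Int.emod_nonneg p hn.ne'
    have := Int.emod_lt_of_pos p hn
    omega⟩

lemma idx_val (p : ℤ) : (((idx p : Fin n) : ℕ) : ℤ) = p % n :=
  Int.toNat_of_nonneg (Int.emod_nonneg p (by exact_mod_cast NeZero.ne n))

lemma idx_cast (p : ℤ) : (((idx p : Fin n) : ℕ) : ZMod n) = p := by
  have : ((((idx p : Fin n) : ℕ) : ℤ) : ZMod n) = p := by
    rw [idx_val, ZMod.intCast_mod]
  exact_mod_cast this

lemma idx_coe (i : Fin n) : (idx (i : ℕ) : Fin n) = i := by
  ext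
  have := idx_val (n := n) (i : ℕ)
  rw [Int.emod_eq_of_lt (by omega) (by exact_mod_cast i.2)] at this
  exact_mod_cast this

lemma idx_add_mul (p k : ℤ) : (idx (p + k * n) : Fin n) = idx p := by
  simp [idx]

lemma idx_succ (p : ℤ) :
    (((idx (p + 1) : Fin n) : ℕ) = (idx p : Fin n) + 1 ∧ (p + 1) / n = p / n) ∨
    (((idx p : Fin n) : ℕ) = n - 1 ∧ ((idx (p + 1) : Fin n) : ℕ) = 0 ∧ (p + 1) / n = p / n + 1) := by
  have hn : (0 : ℤ) < n := by exact_mod_cast Nat.pos_of_ne_zero (NeZero.ne n)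
  have h1 := idx_val (n := n) p
  have h2 := idx_val (n := n) (p + 1)
  have h3 := Int.emod_add_mul_ediv p n
  have h4 := Int.emod_nonneg p hn.ne'
  have h5 := Int.emod_lt_of_pos p hn
  rcases eq_or_ne (p % n) (n - 1) with h | h
  · right
    have e : p + 1 = 0 + (p / n + 1) * n := by linear_combination -h3 + h
    have e1 : (p + 1) % n = 0 := by rw [e, Int.add_mul_emod_self_right]; simp
    have e2 : (p + 1) / n = p / n + 1 := by rw [e, Int.add_mul_ediv_right _ _ hn.ne']; simp
    omega
  · left
    have e : p + 1 = (p % n + 1) + (p / n) * n := by linear_combination -h3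
    have e1 : (p + 1) % n = p % n + 1 := by
      rw [e, Int.add_mul_emod_self_right, Int.emod_eq_of_lt (by omega) (by omega)]
    have e2 : (p + 1) / n = p / n := by
      rw [e, Int.add_mul_ediv_right _ _ hn.ne', Int.ediv_eq_zero_of_lt (by omega) (by omega)]; simp
    omega

end Index

variable {K : Type*} [Field K] {n : ℕ} {q t : Kˣ} (M : Type*) [AddCommGroup M] [Module K M]
  [Module (DAHA K n q t) M] [IsScalarTower K (DAHA K n q t) M]

variable (K n q t) in
/-- The action of the free algebra on a module over the double affine Hecke algebra. -/
def act : FA K n →ₐ[K] Module.End K M :=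
  (Algebra.lsmul K K M).comp (RingQuot.mkAlgHom K (DahaRel K n q t))

lemma act_rel {a b : FA K n} (hab : DahaRel K n q t a b) :
    act K n q t M a = act K n q t M b := by
  rw [act, AlgHom.comp_apply, AlgHom.comp_apply, RingQuot.mkAlgHom_rel K hab]

@[simp] lemma act_sc (c : K) : act K n q t M (sc K n c) = c • 1 := by
  rw [sc, AlgHom.commutes, Algebra.algebraMap_eq_smul_one]

variable (K n q t) in
/-- The invertible operator by which `π` acts. -/
def unitP : (Module.End K M)ˣ where
  val := act K n q t M (gP K n)
  inv := act K n q t M (gPinv K n)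
  val_inv := by rw [← map_mul, act_rel M .pPinv, map_one]
  inv_val := by rw [← map_mul, act_rel M .pinvP, map_one]

lemma mul_eq_of_conj {P A B : FA K n} {Q : FA K n} (hQ : act K n q t M Q * act K n q t M P = 1)
    (h : act K n q t M (P * A * Q) = act K n q t M B) :
    act K n q t M P * act K n q t M A = act K n q t M B * act K n q t M P := by
  rw [← h, map_mul, map_mul, mul_assoc _ _ (act K n q t M P), hQ, mul_one]

variable {M} in
lemma act_Y_of_mem_wtSet {z : Fin n → Kˣ} {u : M} (hu : u ∈ wtSet K n q t M z) (i : Fin n) :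
    act K n q t M (gY K n i) u = (z i : K) • u := by
  have := hu i
  rwa [algebraMap_smul] at this

variable [NeZero n]

variable (K n q t) in
/-- The quasi-periodic extension of the operators by which the `Y i` act. -/
def opX (p : ℤ) : Module.End K M := ((q⁻¹ : Kˣ) : K) ^ (p / n) • act K n q t M (gY K n (idx p))

lemma opX_apply (p : ℤ) (u : M) :
    opX K n q t M p u = ((q⁻¹ : Kˣ) : K) ^ (p / n) • act K n q t M (gY K n (idx p)) u := rfl

variable (K n q t) in
/-- A module over the double affine Hecke algebra, in periodic form. -/
def toDahaAction : DahaAction K M n ((t : K) - ((t⁻¹ : Kˣ) : K)) where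
  T i := act K n q t M (gT K n (i + 1))
  X := opX K n q t M
  P := unitP K n q t M
  quad i u := by
    have h1 := act_rel M (DahaRel.hecke (q := q) (t := t) (i + 1))
    simp only [map_mul, map_sub, map_add, act_sc, map_zero] at h1
    have h2 := LinearMap.congr_fun h1 u
    simp only [Module.End.mul_apply, LinearMap.sub_apply, LinearMap.add_apply,
      LinearMap.smul_apply, Module.End.one_apply, LinearMap.zero_apply, map_add, map_smul] at h2
    have h3 : ((t⁻¹ : Kˣ) : K) * (t : K) = 1 := t.inv_mul
    rw [smul_sub, smul_smul, h3, one_smul] at h2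
    rw [← sub_eq_zero, ← h2]
    module
  braid i u := by
    have h1 := act_rel M (DahaRel.braid (q := q) (t := t) (i + 1))
    simp only [map_mul] at h1
    exact LinearMap.congr_fun h1 u
  comm i j u h1 h2 := by
    have h3 := act_rel M (DahaRel.tcomm (q := q) (t := t) (i + 1) (j + 1)
      (fun h => h1 (add_right_cancel h)) (fun h => h2 (add_right_cancel h)))
    simp only [map_mul] at h3
    exact LinearMap.congr_fun h3 u
  X_comm p r := by
    have h1 : Commute (act K n q t M (gY K n (idx p))) (act K n q t M (gY K n (idx r))) := by
      rw [Commute, SemiconjBy, ← map_mul, ← map_mul]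
      exact act_rel M (.ycomm _ _)
    exact (h1.smul_left _).smul_right _
  T_X_T p u := by
    rw [opX_apply, opX_apply, map_smul]
    rcases idx_succ (n := n) p with ⟨h1, h2⟩ | ⟨h1, h2, h3⟩
    · have h4 := act_rel M (DahaRel.tyt (q := q) (t := t) _ _ h1)
      simp only [map_mul] at h4
      push_cast [idx_cast] at h4
      rw [h2, ← h4]; rfl
    · have h4 := act_rel M (DahaRel.t0yt0 (q := q) (t := t) _ _ h1 h2)
      simp only [map_mul, act_sc] at h4
      have h5 : (p : ZMod n) + 1 = 0 := by
        rw [← idx_cast, h1, Nat.cast_sub (Nat.one_le_iff_ne_zero.2 (NeZero.ne n))]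
        simp
      rw [h3, h5, zpow_add_one₀ (Units.ne_zero _), mul_smul]
      congr 1
      have h6 := LinearMap.congr_fun h4 u
      simpa using h6
  T_X_comm i p u h1 h2 := by
    rw [opX_apply, opX_apply, map_smul]
    have h3 := act_rel M (DahaRel.tycomm (q := q) (t := t) (i + 1) (idx p)
      (by push_cast [idx_cast]; exact fun h => h1 (add_right_cancel h))
      (by push_cast [idx_cast]; exact fun h => h2 (add_right_cancel h)))
    simp only [map_mul] at h3
    congr 1
    exact LinearMap.congr_fun h3 u
  P_T i := mul_eq_of_conj M (unitP K n q t M).inv_mul (act_rel M (.ptp (i + 1)))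
  P_X p := by
    have h0 := (unitP K n q t M).inv_mul
    rw [opX, opX, mul_smul_comm, smul_mul_assoc]
    rcases idx_succ (n := n) p with ⟨h1, h2⟩ | ⟨h1, h2, h3⟩
    · rw [h2]
      congr 1
      exact mul_eq_of_conj M h0 (act_rel M (.pyp _ _ h1))
    · rw [h3, zpow_add_one₀ (Units.ne_zero _), mul_smul]
      congr 1
      have h4 := mul_eq_of_conj M h0 (act_rel M (.pynp _ _ h1 h2))
      rw [map_mul, act_sc, smul_mul_assoc, one_mul, smul_mul_assoc] at h4
      exact h4

/-- The quasi-periodic extension of a weight. -/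
def extWeight (q : Kˣ) (z : Fin n → Kˣ) (p : ℤ) : K := ((q⁻¹ : Kˣ) : K) ^ (p / n) * z (idx p)

lemma quasiPeriodic_extWeight (q : Kˣ) (z : Fin n → Kˣ) :
    DahaAction.QuasiPeriodic n ((q⁻¹ : Kˣ) : K) (extWeight q z) where
  ne_zero p := mul_ne_zero (zpow_ne_zero _ (Units.ne_zero _)) (Units.ne_zero _)
  add_mul p k := by
    rw [extWeight, extWeight, idx_add_mul,
      Int.add_mul_ediv_right _ _ (by exact_mod_cast NeZero.ne n),
      zpow_add₀ (Units.ne_zero _)]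
    ring

variable {M}

lemma isWeight_of_mem_wtSet {z : Fin n → Kˣ} {u : M} (hu : u ∈ wtSet K n q t M z) :
    (toDahaAction K n q t M).IsWeight (extWeight q z) u := fun p => by
  change opX K n q t M p u = _
  rw [opX_apply, act_Y_of_mem_wtSet hu, smul_smul, extWeight]

lemma iSup_eigenspace_opX
    (hss : Submodule.span K (⋃ w : Fin n → Kˣ, wtSet K n q t M w) = ⊤) (p : ℤ) :
    ⨆ μ, ((toDahaAction K n q t M).X p).eigenspace μ = ⊤ := by
  rw [eq_top_iff, ← hss, Submodule.span_le]
  intro u hu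
  obtain ⟨w, hw⟩ := Set.mem_iUnion.1 hu
  exact Submodule.mem_iSup_of_mem _
    (Module.End.mem_eigenspace_iff.2 (isWeight_of_mem_wtSet hw p))

lemma span_eq_top_of_stable [IsSimpleModule (DAHA K n q t) M] (s : Set M)
    (hY : ∀ u ∈ s, ∃ y : ℤ → K, (∀ p, y p ≠ 0) ∧ (toDahaAction K n q t M).IsWeight y u)
    (hT : ∀ u ∈ s, ∀ i, (toDahaAction K n q t M).T i u ∈ Submodule.span K s)
    (hP : ∀ u ∈ s, ∀ m : ℤ,
      (((toDahaAction K n q t M).P ^ m : (Module.End K M)ˣ) : Module.End K M) u ∈ s)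
    (hne : ∃ u ∈ s, u ≠ 0) : Submodule.span K s = ⊤ := by
  have hYact : ∀ u ∈ s, ∀ i : Fin n, ∃ c : K, c ≠ 0 ∧ act K n q t M (gY K n i) u = c • u := by
    intro u hu i
    obtain ⟨y, hy0, hy⟩ := hY u hu
    refine ⟨y (i : ℕ), hy0 _, ?_⟩
    have h1 : opX K n q t M (i : ℕ) u = y (i : ℕ) • u := hy _
    rwa [opX_apply, idx_coe, Int.ediv_eq_zero_of_lt (by omega) (by exact_mod_cast i.2), zpow_zero,
      one_smul] at h1
  have hgen : ∀ g : DGen n, ∀ u ∈ s, act K n q t M (FreeAlgebra.ι K g) u ∈ Submodule.span K s := by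
    intro g u hu
    cases g with
    | T i =>
      have : (toDahaAction K n q t M).T (i - 1) u = act K n q t M (FreeAlgebra.ι K (.T i)) u := by
        simp [toDahaAction, gT]
      exact this ▸ hT u hu (i - 1)
    | P =>
      have h1 := hP u hu 1
      rw [zpow_one] at h1
      exact Submodule.subset_span h1
    | Pinv =>
      have h1 := hP u hu (-1)
      rw [zpow_neg_one] at h1
      exact Submodule.subset_span h1
    | Y i =>
      obtain ⟨c, -, hc⟩ := hYact u hu i
      change act K n q t M (gY K n i) u ∈ _
      rw [hc]
      exact Submodule.smul_mem _ _ (Submodule.subset_span hu)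
    | Yinv i =>
      obtain ⟨c, hc0, hc⟩ := hYact u hu i
      change act K n q t M (gYinv K n i) u ∈ _
      have h1 := LinearMap.congr_fun (act_rel M (DahaRel.yinvY (q := q) (t := t) i)) u
      rw [map_mul, map_one, Module.End.mul_apply, hc, map_smul, Module.End.one_apply] at h1
      rw [← inv_smul_smul₀ hc0 (act K n q t M (gYinv K n i) u), h1]
      exact Submodule.smul_mem _ _ (Submodule.subset_span hu)
  have hact : ∀ a : FA K n, ∀ u ∈ Submodule.span K s, act K n q t M a u ∈ Submodule.span K s := by
    intro a
    induction a using FreeAlgebra.induction with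
    | grade0 c =>
      intro u hu
      rw [AlgHom.commutes]
      exact Submodule.smul_mem _ c hu
    | grade1 g =>
      intro u hu
      exact (Submodule.span_le (p := (Submodule.span K s).comap _)).2 (hgen g) hu
    | mul a b ha hb =>
      intro u hu
      rw [map_mul]
      exact ha _ (hb _ hu)
    | add a b ha hb =>
      intro u hu
      rw [map_add]
      exact Submodule.add_mem _ (ha _ hu) (hb _ hu)
  let N : Submodule (DAHA K n q t) M :=
    { (Submodule.span K s).toAddSubmonoid with
      smul_mem' := fun a u hu => by
        obtain ⟨a, rfl⟩ := RingQuot.mkAlgHom_surjective K (DahaRel K n q t) a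
        exact hact a u hu }
  obtain ⟨u, hu, hu0⟩ := hne
  have huN : u ∈ N := Submodule.subset_span (R := K) hu
  have hN : N = ⊤ := (eq_bot_or_eq_top N).resolve_left fun hb => hu0 (by rw [hb] at huN; exact huN)
  rw [eq_top_iff]
  intro x _
  have hx : x ∈ N := hN ▸ Submodule.mem_top
  exact hx

end DAHA

/-- If `M` is a simple, `Y`-semisimple `H_{q,t}(GL_n)`-module (with `q, t` not
roots of unity), then every weight space of `M` has `K`-dimension at most `1`. -/
theorem stmt12 (K : Type*) [Field K] (n : ℕ) (hn : 2 ≤ n) (q t : Kˣ)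
    (hq : ∀ m : ℕ, 1 ≤ m → q ^ m ≠ 1) (ht : ∀ m : ℕ, 1 ≤ m → t ^ m ≠ 1)
    (M : Type*) [AddCommGroup M] [Module K M] [Module (DAHA K n q t) M]
    [IsScalarTower K (DAHA K n q t) M]
    (hsimple : IsSimpleModule (DAHA K n q t) M)
    (hss : Submodule.span K (⋃ w : Fin n → Kˣ, wtSet K n q t M w) = ⊤)
    (z : Fin n → Kˣ) :
    Module.rank K ↥(Submodule.span K (wtSet K n q t M z)) ≤ 1 := by
  have : NeZero n := ⟨by omega⟩
  have : Fact (1 < n) := ⟨hn⟩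
  have hh : (t : K) - ((t⁻¹ : Kˣ) : K) ≠ 0 := by
    intro h
    have h1 : t = t⁻¹ := Units.ext (sub_eq_zero.1 h)
    exact ht 2 (by norm_num) (by rw [pow_two]; nth_rewrite 2 [h1]; exact mul_inv_cancel t)
  have hqz : ∀ k : ℤ, ((q⁻¹ : Kˣ) : K) ^ k = 1 → k = 0 := by
    intro k hk
    have h1 : q ^ k = 1 := by
      have h2 : (q⁻¹) ^ k = 1 := Units.ext (by simpa using hk)
      rwa [inv_zpow, inv_eq_one] at h2
    by_contra hk0
    refine hq k.natAbs (Int.natAbs_pos.2 hk0) ?_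
    rcases Int.natAbs_eq k with e | e <;> rw [e] at h1
    · rwa [zpow_natCast] at h1
    · rwa [zpow_neg, inv_eq_one, zpow_natCast] at h1
  rw [rank_submodule_le_one_iff']
  by_cases hv : ∃ v ∈ wtSet K n q t M z, v ≠ 0
  · obtain ⟨v, hv, hv0⟩ := hv
    refine ⟨v, Submodule.span_le.2 fun x hx => ?_⟩
    exact (DAHA.toDahaAction K n q t M).mem_span_of_isWeight hh
      (DAHA.quasiPeriodic_extWeight q z) (Units.ne_zero _) hqz (DAHA.iSup_eigenspace_opX hss)
      DAHA.span_eq_top_of_stable (DAHA.isWeight_of_mem_wtSet hv) hv0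
      (DAHA.isWeight_of_mem_wtSet hx)
  · push Not at hv
    refine ⟨0, Submodule.span_le.2 fun x hx => ?_⟩
    rw [hv x hx]
    exact Submodule.zero_mem _
end
end
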